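/- Let ϖ∨ be a minuscule fundamental coweight with corresponding fundamental weight ϖ, let ϖ* := −w₀(ϖ), and let N be the smallest positive integer such that Nϖ∨ lies in the coroot lattice of Δ. Then the set of concatenated paths Λ₀ ⋆ B(ϖ*) ⋆ ⋯ ⋆ B(ϖ*) (with N factors B(ϖ*)) contains exactly one affine-dominant path. -/

import Mathlib

/-
Background: reduced irreducible crystallographic root systems with a chosen base,
realized in a real inner product space.  Coweights are represented as vectors of the
same space via the `W`-invariant inner product (so the coroot of `a` is `2a/(a,a)`).
-/

open scoped RealInnerProductSpace Classical

noncomputable section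

namespace Litt

variable {V : Type*} [NormedAddCommGroup V] [InnerProductSpace ℝ V]

/-- The coroot of a root vector, under the inner-product identification of `𝔥` with `𝔥*`. -/
def coroot (a : V) : V := (2 / ⟪a, a⟫) • a

/-- The pairing `⟨x, α∨⟩` of a weight `x` with the coroot of `a`. -/
def pairc (x a : V) : ℝ := ⟪x, coroot a⟫

/-- The reflection `s_a (x) = x - ⟨x, a∨⟩ a`, as a linear map. -/
def sLin (a : V) : V →ₗ[ℝ] V :=
  LinearMap.id - ((innerₛₗ ℝ (coroot a)).smulRight a)

/-- A reduced irreducible crystallographic root system spanning `V`, together with a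
chosen system of simple roots `α 0, …, α (r-1)`. -/
structure RootSystemBase (r : ℕ) (V : Type*) [NormedAddCommGroup V]
    [InnerProductSpace ℝ V] where
  roots : Set V
  α : Fin r → V
  finite : roots.Finite
  ne_zero : ∀ a ∈ roots, a ≠ 0
  span_top : Submodule.span ℝ roots = ⊤
  reduced : ∀ a ∈ roots, ∀ t : ℝ, t • a ∈ roots → t = 1 ∨ t = -1
  reflect_mem : ∀ a ∈ roots, ∀ b ∈ roots, sLin a b ∈ roots
  cryst : ∀ a ∈ roots, ∀ b ∈ roots, ∃ n : ℤ, pairc b a = (n : ℝ)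
  irred : ∀ S T : Set V, roots = S ∪ T → (∀ a ∈ S, ∀ b ∈ T, ⟪a, b⟫ = 0) →
    S = ∅ ∨ T = ∅
  simple_mem : ∀ i, α i ∈ roots
  simple_indep : LinearIndependent ℝ α
  pos_or_neg : ∀ a ∈ roots, (∃ c : Fin r → ℕ, a = ∑ i, (c i : ℝ) • α i) ∨
    (∃ c : Fin r → ℕ, a = -∑ i, (c i : ℝ) • α i)

namespace RootSystemBase

variable {r : ℕ} (R : RootSystemBase r V)

/-- The positive roots determined by the base. -/
def pos : Set V := {a ∈ R.roots | ∃ c : Fin r → ℕ, a = ∑ i, (c i : ℝ) • R.α i}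

/-- `w` is the fundamental weight at node `i`:  `⟨w, α_j∨⟩ = δ_ij`. -/
def IsFundWeight (i : Fin r) (w : V) : Prop :=
  ∀ j, pairc w (R.α j) = if j = i then 1 else 0

/-- `c` is (the image under `ν` of) the fundamental coweight at node `i`:
`⟨α_j, ϖ_i∨⟩ = δ_ij`, the pairing of a root with a coweight being realized by the
inner product. -/
def IsFundCoweight (i : Fin r) (c : V) : Prop :=
  ∀ j, ⟪R.α j, c⟫ = if j = i then 1 else 0

/-- A coweight is minuscule if it pairs to `0` or `1` with every positive root. -/
def IsMinusculeCoweight (c : V) : Prop :=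
  ∀ a ∈ R.pos, ⟪a, c⟫ = 0 ∨ ⟪a, c⟫ = 1

/-- The Weyl group: the subgroup of `GL(V)` generated by the simple reflections. -/
def weyl : Subgroup (V ≃ₗ[ℝ] V) :=
  Subgroup.closure {g | ∃ i : Fin r, ∀ x, g x = sLin (R.α i) x}

/-- The orbit `W·λ` of a weight under the Weyl group. -/
def orbit (lam : V) : Set V := {x | ∃ g ∈ R.weyl, x = g lam}

/-- `w` is the longest element `w₀` of the Weyl group: it sends every positive root to a
negative root. -/
def IsLongest (w : V ≃ₗ[ℝ] V) : Prop :=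
  w ∈ R.weyl ∧ ∀ a ∈ R.pos, -(w a) ∈ R.pos

/-- `w` is the longest element of the parabolic subgroup `Stab_W(ϖ)`: it stabilizes `ϖ`
and sends every positive root pairing to `0` with `ϖ` to a negative root. -/
def IsLongestPar (ϖ : V) (w : V ≃ₗ[ℝ] V) : Prop :=
  w ∈ R.weyl ∧ w ϖ = ϖ ∧ ∀ a ∈ R.pos, pairc ϖ a = 0 → -(w a) ∈ R.pos

/-- `θ` is the highest root: for every root `a`, `θ - a` is a nonnegative combination of
the simple roots. -/
def IsHighestRoot (θ : V) : Prop :=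
  θ ∈ R.pos ∧ ∀ a ∈ R.roots, ∃ c : Fin r → ℕ, θ - a = ∑ i, (c i : ℝ) • R.α i

/-- The coroot lattice, as a `ℤ`-submodule of `V`. -/
def corootLattice : Submodule ℤ V := Submodule.span ℤ (coroot '' R.roots)

end RootSystemBase

end Litt
namespace Litt

/-! ### Littelmann paths as lists of steps

A piecewise-linear path `π = (v₁ ⋆ ⋯ ⋆ v_k)` starting at `0` is recorded by its list of
steps `[v₁, …, v_k]`.  Two step lists describe the same path up to reparametrization
iff they have the same `normalize`d form (zero steps removed, consecutive positively
proportional steps merged). -/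

variable {M : Type*} [AddCommGroup M] [Module ℝ M]

/-- Prepend one step to a normalized list of steps, merging it with the head if the two
are positively proportional and dropping it if it is zero. -/
def consStep (v : M) : List M → List M
  | [] => if v = 0 then [] else [v]
  | w :: L =>
      if v = 0 then w :: L
      else if ∃ c : ℝ, 0 < c ∧ w = c • v then (v + w) :: L else v :: w :: L

/-- The normal form of a step list: two step lists represent the same piecewise-linear
path up to reparametrization iff their normal forms coincide. -/
def normalize : List M → List M := List.foldr consStep []

/-- The concatenation `S₁ ⋆ S₂` of two sets of paths. -/
def starSet (S₁ S₂ : Set (List M)) : Set (List M) := Set.image2 (· ++ ·) S₁ S₂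

/-- The concatenation `S₁ ⋆ ⋯ ⋆ S_m` of a list of sets of paths. -/
def catSets : List (Set (List M)) → Set (List M)
  | [] => {([] : List M)}
  | S :: Ss => starSet S (catSets Ss)

/-- The data of a root operator in the sense of Littelmann: a root vector `vec` (a root
of `𝔤`, or a real root of `𝔤̂` modulo `δ`) together with the linear functional `cov`
given by pairing with its coroot. -/
structure RootOp (M : Type*) [AddCommGroup M] [Module ℝ M] where
  vec : M
  cov : M →ₗ[ℝ] ℝ

namespace RootOp

variable (d : RootOp M)

/-- The associated reflection `s_i x = x - ⟨x, α_i∨⟩ α_i`. -/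
def s (x : M) : M := x - d.cov x • d.vec

/-- The value `h_i` of the height function at the `j`-th corner of the path;
since the height function is affine on each step, its extrema on the path are
attained at corners. -/
def hgt (L : List M) (j : ℕ) : ℝ := d.cov ((L.take j).sum)

/-- The minimum `M` of the height function `h_i` along the path. -/
def minH (L : List M) : ℝ := sInf ((d.hgt L) '' {j | j ≤ L.length})

/-- The corner at which the height function attains its minimum for the last time. -/
def lastMin (L : List M) : ℕ := sSup {j | j ≤ L.length ∧ d.hgt L j = d.minH L}

/-- `f_i` is defined on `π` iff after the last minimum of the height function the height
rises to `M + 1`. -/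
def fDef (L : List M) : Prop :=
  ∃ j ≤ L.length, d.lastMin L < j ∧ d.minH L + 1 ≤ d.hgt L j

/-- The first corner after the last minimum at which the height has reached `M + 1`
(the height first reaches `M + 1` within the step leading to this corner). -/
def fIdx (L : List M) : ℕ :=
  sInf {j | d.lastMin L < j ∧ d.minH L + 1 ≤ d.hgt L j}

/-- The lowering root operator `f_i` on paths (meaningful when `fDef` holds): writing
`π = π₁ ⋆ π₂ ⋆ π₃` where `π₂` is the last subpath on which `M ≤ h_i ≤ M + 1` — it runs
from the last minimum of the height function to the first subsequent point where the
height reaches `M + 1`, splitting the step through which the latter occurs — one sets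
`f_i π := π₁ ⋆ s_i π₂ ⋆ π₃`. -/
def fList (L : List M) : List M :=
  let j1 := d.lastMin L
  let j2 := d.fIdx L
  let v := L.getD (j2 - 1) 0
  let c := (d.minH L + 1 - d.hgt L (j2 - 1)) / (d.hgt L j2 - d.hgt L (j2 - 1))
  L.take j1 ++ ((((L.drop j1).take (j2 - 1 - j1)).map d.s) ++ [d.s (c • v)])
    ++ ([(1 - c) • v] ++ L.drop j2)

/-- The root operator `f_i` as a relation between paths. -/
def frel (L L' : List M) : Prop := d.fDef L ∧ L' = d.fList L

/-- The root operator `f_i` as a relation between paths up to reparametrization. -/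
def frelC (L L' : List M) : Prop :=
  ∃ L₁, normalize L₁ = normalize L ∧ d.fDef L₁ ∧ normalize L' = normalize (d.fList L₁)

end RootOp

/-- The closure of a set of paths under a single root operator `f_i`:
`{f_i^k π ∣ π ∈ S, k ≥ 0}`. -/
def fClos (d : RootOp M) (S : Set (List M)) : Set (List M) :=
  {L' | ∃ L ∈ S, Relation.ReflTransGen d.frel L L'}

/-- The set of paths generated from a set of paths by the root operators `f_i`. -/
def genF {ι : Type*} (D : ι → RootOp M) (S : Set (List M)) : Set (List M) :=
  {L' | ∃ L ∈ S, Relation.ReflTransGen (fun x y => ∃ i, (D i).frel x y) L L'}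

/-- The set of paths generated from a set of paths by the root operators `f_i` and
their inverses `e_i` (recall `e_i π = π' ↔ f_i π' = π`). -/
def genFE {ι : Type*} (D : ι → RootOp M) (S : Set (List M)) : Set (List M) :=
  {L' | ∃ L ∈ S,
    Relation.ReflTransGen (fun x y => ∃ i, (D i).frel x y ∨ (D i).frel y x) L L'}

/-- The Demazure operator `B̂_z` attached to the word `w = [i₁, …, i_m]` (a reduced word
for `z`):  `B̂_z(S) = {f_{i₁}^{k₁} ⋯ f_{i_m}^{k_m} π ∣ π ∈ S, k₁, …, k_m ≥ 0}`. -/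
def demazureWord {ι : Type*} (D : ι → RootOp M) : List ι → Set (List M) → Set (List M)
  | [] => id
  | i :: w => fun S => fClos (D i) (demazureWord D w S)

end Litt
namespace Litt

/-! ### The affine weight space modulo `ℝδ`

The affine weight space `𝔥*_ℝ ⊕ ℝΛ₀` (working modulo `ℝδ` throughout) is realized as
`V × ℝ`, a weight `λ + ℓΛ₀` being the pair `(λ, ℓ)`.  The affine Weyl group and the
translations `t_μ : λ + ℓΛ₀ ↦ λ + ℓμ + ℓΛ₀` act linearly on it. -/

variable {V : Type*} [NormedAddCommGroup V] [InnerProductSpace ℝ V]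

/-- The functional `λ + ℓΛ₀ ↦ ⟨λ, a∨⟩` on the affine weight space. -/
def affCovF (a : V) : (V × ℝ) →ₗ[ℝ] ℝ :=
  (innerₛₗ ℝ (coroot a)).comp (LinearMap.fst ℝ V ℝ)

/-- `Λ₀ = (0, 1)`. -/
def lamZero : V × ℝ := ((0 : V), (1 : ℝ))

/-- The translation `t_μ` acting (mod `ℝδ`) on the affine weight space:
`λ + ℓΛ₀ ↦ λ + ℓμ + ℓΛ₀`. -/
def translLin (μ : V) : (V × ℝ) →ₗ[ℝ] (V × ℝ) :=
  (LinearMap.fst ℝ V ℝ + (LinearMap.snd ℝ V ℝ).smulRight μ).prod (LinearMap.snd ℝ V ℝ)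

/-- The extension of a linear map on `V` to the affine weight space, fixing `Λ₀`. -/
def affExt (g : V →ₗ[ℝ] V) : (V × ℝ) →ₗ[ℝ] (V × ℝ) :=
  (g.comp (LinearMap.fst ℝ V ℝ)).prod (LinearMap.snd ℝ V ℝ)

/-- The pointwise action of a (piecewise-linearity preserving) transformation of the
affine weight space on a path, recorded on step lists via the corner points. -/
def mapSteps (g : (V × ℝ) → (V × ℝ)) (L : List (V × ℝ)) : List (V × ℝ) :=
  (List.range L.length).map fun j => g ((L.take (j + 1)).sum) - g ((L.take j).sum)

namespace RootSystemBase

variable {r : ℕ} (R : RootSystemBase r V)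

/-- The affine root operators (for `𝔤̂`, mod `ℝδ`): index `0` is the affine node, with
root `α₀ = δ - θ ≡ -θ` and pairing `⟨λ + ℓΛ₀, α₀∨⟩ = ℓ - ⟨λ, θ∨⟩`; index `i.succ` is
the finite node `i`, with root `α_i` and pairing `⟨λ + ℓΛ₀, α_i∨⟩ = ⟨λ, α_i∨⟩`. -/
def affOp (θ : V) : Fin (r + 1) → RootOp (V × ℝ) :=
  Fin.cases ⟨((-θ : V), (0 : ℝ)), LinearMap.snd ℝ V ℝ - affCovF θ⟩
    (fun i => ⟨((R.α i : V), (0 : ℝ)), affCovF (R.α i)⟩)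

/-- A path in the affine weight space is dominant if it stays in the fundamental
chamber: `⟨π(t), α_i∨⟩ ≥ 0` for all `t ∈ [0,1]` and all `i = 0, …, r`  (the heights
being affine on each step, this holds iff it holds at every corner). -/
def AffDominant (θ : V) (L : List (V × ℝ)) : Prop :=
  ∀ j ≤ L.length, ∀ i : Fin (r + 1), 0 ≤ (R.affOp θ i).hgt L j

/-- A path is integral if all its steps are integral weights. -/
def AffIntegral (θ : V) (L : List (V × ℝ)) : Prop :=
  ∀ v ∈ L, ∀ i : Fin (r + 1), ∃ n : ℤ, (R.affOp θ i).cov v = (n : ℝ)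

/-- The Littelmann crystal `B(μ)` generated from the straight-line path `(μ)` by the
root operators `f_1, …, f_r` of the finite algebra `𝔤`, embedded in the affine weight
space at level `0`. -/
def finCrystal (μ : V) : Set (List (V × ℝ)) :=
  genF (fun i : Fin r => RootOp.mk ((R.α i : V), (0 : ℝ)) (affCovF (R.α i)))
    {[((μ : V), (0 : ℝ))]}

/-- The product `s_{i₁} ⋯ s_{i_m}` of the affine simple reflections along a word. -/
def wordProd (θ : V) (w : List (Fin (r + 1))) : (V × ℝ) → (V × ℝ) :=
  (w.map fun i => (R.affOp θ i).s).foldr (· ∘ ·) id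

/-- `w` is a reduced word for the transformation `z` of the affine weight space:
its product is `z` and no shorter word of affine simple reflections has product `z`. -/
def IsReducedWord (θ : V) (z : (V × ℝ) → (V × ℝ)) (w : List (Fin (r + 1))) : Prop :=
  R.wordProd θ w = z ∧ ∀ w', R.wordProd θ w' = z → w.length ≤ w'.length

end RootSystemBase

end Litt
namespace Litt

section Paths

variable {M : Type*} [AddCommGroup M] [Module ℝ M]

namespace RootOp

variable (d : RootOp M)

lemma hgt_of_length_le (L : List M) {k : ℕ} (hk : L.length ≤ k) :
    d.hgt L k = d.hgt L L.length := by
  simp [hgt, List.take_of_length_le hk]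

lemma finite_hgt_image (L : List M) : ((d.hgt L) '' {j | j ≤ L.length}).Finite :=
  (Set.finite_Iic L.length).image _

lemma minH_le (L : List M) (k : ℕ) : d.minH L ≤ d.hgt L k := by
  rcases le_total k L.length with hk | hk
  · exact csInf_le (d.finite_hgt_image L).bddBelow ⟨k, hk, rfl⟩
  · rw [d.hgt_of_length_le L hk]
    exact csInf_le (d.finite_hgt_image L).bddBelow ⟨L.length, le_refl L.length, rfl⟩

lemma lastMin_spec (L : List M) :
    d.lastMin L ≤ L.length ∧ d.hgt L (d.lastMin L) = d.minH L ∧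
      ∀ k ≤ L.length, d.lastMin L < k → d.minH L < d.hgt L k := by
  have hne : ((d.hgt L) '' {j | j ≤ L.length}).Nonempty :=
    ⟨_, 0, Nat.zero_le L.length, rfl⟩
  obtain ⟨j, hj, hjM⟩ := hne.csInf_mem (d.finite_hgt_image L)
  have hbdd : BddAbove {j | j ≤ L.length ∧ d.hgt L j = d.minH L} :=
    ⟨L.length, fun k hk => hk.1⟩
  have hmem : d.lastMin L ∈ {j | j ≤ L.length ∧ d.hgt L j = d.minH L} :=
    Nat.sSup_mem ⟨j, hj, hjM⟩ hbdd
  refine ⟨hmem.1, hmem.2, fun k hk hlt => lt_of_le_of_ne (d.minH_le L k) fun h => ?_⟩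
  exact absurd (le_csSup hbdd ⟨hk, h.symm⟩) (not_le.mpr hlt)

lemma fIdx_spec {L : List M} (hf : d.fDef L) :
    d.fIdx L ≤ L.length ∧ d.lastMin L < d.fIdx L ∧
      d.minH L + 1 ≤ d.hgt L (d.fIdx L) ∧
      ∀ k, d.lastMin L < k → k < d.fIdx L → d.hgt L k < d.minH L + 1 := by
  obtain ⟨j, hj, hlt, hle⟩ := hf
  have hmem : d.fIdx L ∈ {j | d.lastMin L < j ∧ d.minH L + 1 ≤ d.hgt L j} :=
    Nat.sInf_mem ⟨j, hlt, hle⟩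
  refine ⟨(Nat.sInf_le (show j ∈ {j | d.lastMin L < j ∧ d.minH L + 1 ≤ d.hgt L j}
    from ⟨hlt, hle⟩)).trans hj, hmem.1, hmem.2, fun k hk hk' => ?_⟩
  by_contra h
  exact Nat.notMem_of_lt_sInf hk' ⟨hk, not_lt.mp h⟩

/-- A path on which `f` is defined splits into the part before the last minimum, the full
steps of the reflected part, the step in which the height reaches the minimum plus one, and
the rest; the conditions are relative heights. -/
lemma fList_decomposition {L : List M} (hf : d.fDef L) :
    ∃ (L₁ L₂ L₃ : List M) (w : M) (c : ℝ), L = L₁ ++ (L₂ ++ w :: L₃) ∧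
      d.fList L = L₁ ++ (L₂.map d.s ++ d.s (c • w) :: (1 - c) • w :: L₃) ∧
      0 < c ∧ c ≤ 1 ∧
      (∀ A B, L₁ = A ++ B → d.cov B.sum ≤ 0) ∧
      (∀ A B, L₂ ++ w :: L₃ = A ++ B → A ≠ [] → 0 < d.cov A.sum) ∧
      (∀ A B, L₂ = A ++ B → d.cov A.sum < 1) ∧
      d.cov L₂.sum + c * d.cov w = 1 := by
  obtain ⟨hj₁, hM, hlast⟩ := d.lastMin_spec L
  obtain ⟨hj₂, hlt, hge, hfirst⟩ := d.fIdx_spec hf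
  have hmin := d.minH_le L
  generalize hj1 : d.lastMin L = j₁ at *
  generalize hj2 : d.fIdx L = j₂ at *
  obtain ⟨m, rfl⟩ : ∃ m, j₂ = j₁ + m + 1 := ⟨j₂ - j₁ - 1, by omega⟩
  set L₁ := L.take j₁ with hL₁
  set L₂ := (L.drop j₁).take m with hL₂
  set L₃ := L.drop (j₁ + m + 1) with hL₃
  have hlt' : j₁ + m < L.length := by omega
  set w := L[j₁ + m] with hw
  have hdrop : L.drop j₁ = L₂ ++ w :: L₃ := by
    rw [hL₂, hw, hL₃, ← List.drop_eq_getElem_cons hlt', ← List.drop_drop,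
      List.take_append_drop]
  have hL : L = L₁ ++ (L₂ ++ w :: L₃) := by
    rw [← hdrop, hL₁, List.take_append_drop]
  have hl₁ : L₁.length = j₁ := by simp [hL₁]; omega
  have hl₂ : L₂.length = m := by simp [hL₂]; omega
  have hh : ∀ A B, L₂ ++ w :: L₃ = A ++ B →
      d.hgt L (j₁ + A.length) = d.minH L + d.cov A.sum := by
    intro A B hAB
    rw [← hM, hgt, hgt, ← hL₁, ← map_add, ← List.sum_append]
    congr 2
    rw [hL, hAB, ← hl₁, List.take_length_add_append]
    simp
  have hlen : ∀ A B, L₂ ++ w :: L₃ = A ++ B → j₁ + A.length ≤ L.length := by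
    intro A B hAB
    rw [hL, hAB]; simp; omega
  have hm : d.hgt L (j₁ + m) = d.minH L + d.cov L₂.sum := by
    rw [← hh L₂ (w :: L₃) rfl, hl₂]
  have hm1 : d.hgt L (j₁ + m + 1) = d.minH L + d.cov L₂.sum + d.cov w := by
    have := hh (L₂ ++ [w]) L₃ (by simp)
    simp [hl₂] at this
    rw [add_assoc, add_assoc, this]
  have hlt1 : d.cov L₂.sum < 1 := by
    rcases Nat.eq_zero_or_pos m with h0 | h0
    · have : L₂ = [] := List.eq_nil_of_length_eq_zero (by omega)
      simp [this]
    · have := hfirst (j₁ + m) (by omega) (by omega)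
      linarith
  have hwpos : 0 < d.cov w := by linarith
  set c := (1 - d.cov L₂.sum) / d.cov w with hc
  refine ⟨L₁, L₂, L₃, w, c, hL, ?_, ?_, ?_, ?_, ?_, ?_, ?_⟩
  · have h1 : j₁ + m + 1 - 1 = j₁ + m := rfl
    have h2 : j₁ + m - j₁ = m := by omega
    have h3 : L.getD (j₁ + m) 0 = w := by
      rw [List.getD_eq_getElem _ _ hlt']
    have h4 : (d.minH L + 1 - d.hgt L (j₁ + m)) /
        (d.hgt L (j₁ + m + 1) - d.hgt L (j₁ + m)) = c := by
      rw [hm1, hm, hc]; congr 1 <;> ring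
    simp only [fList, hj1, hj2, h1, h2, h3, h4, ← hL₁, ← hL₂, ← hL₃]
    simp
  · exact div_pos (by linarith) hwpos
  · rw [hc, div_le_one hwpos]; linarith
  · intro A B hAB
    have h1 := hmin A.length
    rw [← hM, hgt, hgt, ← hL₁, hL, hAB] at h1
    simp at h1
    exact h1
  · intro A B hAB hA
    have h1 := hlast _ (hlen A B hAB)
      (by have := List.length_pos_of_ne_nil hA; omega)
    rw [hh A B hAB] at h1
    linarith
  · intro A B hAB
    rcases eq_or_ne A [] with rfl | hA
    · simp
    · have hl : A.length + B.length = m := by rw [← hl₂, hAB]; simp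
      have h1 := hfirst (j₁ + A.length)
        (by have := List.length_pos_of_ne_nil hA; omega) (by omega)
      rw [hh A (B ++ w :: L₃) (by simp [hAB])] at h1
      linarith
  · rw [hc]; field_simp; ring

end RootOp

lemma consStep_zero (L : List M) : consStep 0 L = L := by
  cases L <;> simp [consStep]

lemma consStep_smul_nil {v : M} (hv : v ≠ 0) {a : ℝ} (ha : 0 < a) :
    consStep (a • v) [] = [a • v] := by
  simp [consStep, hv, ha.ne']

lemma consStep_smul_cons {v : M} (hv : v ≠ 0) {a : ℝ} (ha : 0 < a) (w : M) (L : List M) :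
    consStep (a • v) (w :: L) =
      if ∃ k : ℝ, 0 < k ∧ w = k • v then (a • v + w) :: L else a • v :: w :: L := by
  have hdir : (∃ k : ℝ, 0 < k ∧ w = k • a • v) ↔ ∃ k : ℝ, 0 < k ∧ w = k • v := by
    constructor
    · rintro ⟨k, hk, rfl⟩
      exact ⟨k * a, by positivity, by rw [smul_smul]⟩
    · rintro ⟨k, hk, rfl⟩
      exact ⟨k / a, by positivity, by rw [smul_smul]; congr 1; field_simp⟩
  simp only [consStep, hdir, smul_eq_zero, hv, ha.ne', or_self, if_false]

lemma consStep_smul_consStep_smul (v : M) {a b : ℝ} (ha : 0 ≤ a) (hb : 0 ≤ b) (L : List M) :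
    consStep (a • v) (consStep (b • v) L) = consStep ((a + b) • v) L := by
  rcases eq_or_ne v 0 with rfl | hv
  · simp [consStep_zero]
  rcases ha.eq_or_lt with rfl | ha
  · simp [consStep_zero]
  rcases hb.eq_or_lt with rfl | hb
  · simp [consStep_zero]
  have hab : 0 < a + b := by positivity
  have h1 : ∃ k : ℝ, 0 < k ∧ b • v = k • v := ⟨b, hb, rfl⟩
  cases L with
  | nil =>
    rw [consStep_smul_nil hv hb, consStep_smul_nil hv hab, consStep_smul_cons hv ha, if_pos h1,
      add_smul]
  | cons w L =>
    rw [consStep_smul_cons hv hb, consStep_smul_cons hv hab]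
    by_cases hw : ∃ k : ℝ, 0 < k ∧ w = k • v
    · have h2 : ∃ k : ℝ, 0 < k ∧ b • v + w = k • v := by
        obtain ⟨k, hk, rfl⟩ := hw
        exact ⟨b + k, by positivity, by rw [add_smul]⟩
      rw [if_pos hw, if_pos hw, consStep_smul_cons hv ha, if_pos h2, add_smul, add_assoc]
    · rw [if_neg hw, if_neg hw, consStep_smul_cons hv ha, if_pos h1, add_smul]

/-- `L` runs along the ray through `v`, with total length `s`. -/
inductive Along (v : M) : ℝ → List M → Prop
  | nil : Along v 0 []
  | cons {s c : ℝ} {L : List M} : 0 ≤ c → Along v s L → Along v (c + s) (c • v :: L)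

namespace Along

variable {v : M} {s s' : ℝ} {L L' : List M}

lemma nonneg (h : Along v s L) : 0 ≤ s := by
  induction h with
  | nil => exact le_rfl
  | cons hc _ ih => positivity

lemma sum_eq (h : Along v s L) : L.sum = s • v := by
  induction h with
  | nil => simp
  | cons _ _ ih => simp [ih, add_smul]

lemma append (h : Along v s L) (h' : Along v s' L') : Along v (s + s') (L ++ L') := by
  induction h with
  | nil => simpa using h'
  | cons hc _ ih => rw [add_assoc]; exact .cons hc ih

lemma single {c : ℝ} (hc : 0 ≤ c) : Along v c [c • v] := by
  simpa using Along.cons hc (Along.nil (v := v))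

lemma of_append : ∀ {L L' : List M} {s : ℝ}, Along v s (L ++ L') →
    ∃ a b, s = a + b ∧ Along v a L ∧ Along v b L'
  | [], L', s, h => ⟨0, s, by simp, .nil, h⟩
  | x :: L, L', s, h => by
    rw [List.cons_append] at h
    cases h with
    | cons hc h =>
      obtain ⟨a, b, rfl, ha, hb⟩ := of_append h
      exact ⟨_, b, by ring, .cons hc ha, hb⟩

lemma of_eq_zero (h : Along v s L) (hs : s = 0) (w : M) : Along w 0 L := by
  induction h with
  | nil => exact .nil
  | @cons s c L hc h ih =>
    have := h.nonneg
    obtain rfl : c = 0 := le_antisymm (by linarith) hc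
    simpa using Along.cons (v := w) le_rfl (ih (by linarith))

lemma map {M' : Type*} [AddCommGroup M'] [Module ℝ M'] {g : M → M'} {w : M'}
    (hg : ∀ c : ℝ, g (c • v) = c • w) (h : Along v s L) : Along w s (L.map g) := by
  induction h with
  | nil => exact .nil
  | cons hc _ ih => rw [List.map_cons, hg]; exact .cons hc ih

lemma normalize_append (h : Along v s L) (T : List M) :
    normalize (L ++ T) = consStep (s • v) (normalize T) := by
  induction h with
  | nil => simp [consStep_zero]
  | cons hc h ih =>
    rw [List.cons_append, normalize, List.foldr_cons]
    change consStep _ (normalize _) = _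
    rw [ih, consStep_smul_consStep_smul v hc h.nonneg]
    rfl

end Along

end Paths

section Reflections

variable {V : Type*} [NormedAddCommGroup V] [InnerProductSpace ℝ V]

lemma pairc_eq (x a : V) : pairc x a = 2 * ⟪x, a⟫ / ⟪a, a⟫ := by
  rw [pairc, coroot, real_inner_smul_right]; ring

lemma pairc_mul (x : V) {a : V} (ha : a ≠ 0) : pairc x a * ⟪a, a⟫ = 2 * ⟪x, a⟫ := by
  rw [pairc_eq, div_mul_cancel₀ _ (inner_self_ne_zero.mpr ha)]

lemma pairc_self {a : V} (ha : a ≠ 0) : pairc a a = 2 := by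
  rw [pairc_eq, mul_div_assoc, div_self (inner_self_ne_zero.mpr ha), mul_one]

lemma pairc_sub (x y a : V) : pairc (x - y) a = pairc x a - pairc y a := by
  simp [pairc, inner_sub_left]

lemma pairc_smul (t : ℝ) (x a : V) : pairc (t • x) a = t * pairc x a := by
  simp [pairc, real_inner_smul_left]

lemma pairc_neg_right (x a : V) : pairc x (-a) = -pairc x a := by
  simp [pairc_eq, neg_div]

lemma inner_self_pos_of_ne_zero {a : V} (ha : a ≠ 0) : (0 : ℝ) < ⟪a, a⟫ :=
  real_inner_self_pos.mpr ha

lemma pairc_pos_iff (x : V) {a : V} (ha : a ≠ 0) : 0 < pairc x a ↔ 0 < ⟪x, a⟫ := by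
  have := inner_self_pos_of_ne_zero ha
  rw [pairc_eq, div_pos_iff_of_pos_right this]
  constructor <;> intro h <;> linarith

lemma pairc_nonneg_iff (x : V) {a : V} (ha : a ≠ 0) : 0 ≤ pairc x a ↔ 0 ≤ ⟪x, a⟫ := by
  have h := pairc_pos_iff x (neg_ne_zero.mpr ha)
  rw [pairc_neg_right, inner_neg_right, Left.neg_pos_iff, Left.neg_pos_iff] at h
  rw [← not_lt, h, not_lt]

lemma sLin_apply (a x : V) : sLin a x = x - pairc x a • a := by
  simp [sLin, pairc, real_inner_comm]

lemma sLin_self {a : V} (ha : a ≠ 0) : sLin a a = -a := by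
  rw [sLin_apply, pairc_self ha, two_smul]; abel

lemma inner_sLin_left {a : V} (x y : V) : ⟪sLin a x, y⟫ = ⟪x, sLin a y⟫ := by
  simp only [sLin_apply, inner_sub_left, inner_sub_right,
    real_inner_smul_right, pairc_eq, real_inner_comm]
  ring

lemma sLin_sLin {a : V} (ha : a ≠ 0) (x : V) : sLin a (sLin a x) = x := by
  rw [sLin_apply a (sLin a x), sLin_apply a x, pairc_sub, pairc_smul, pairc_self ha,
    sub_sub, ← add_smul]
  ring_nf
  simp

lemma inner_sLin_sLin {a : V} (ha : a ≠ 0) (x y : V) : ⟪sLin a x, sLin a y⟫ = ⟪x, y⟫ := by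
  rw [inner_sLin_left, sLin_sLin ha]

lemma pairc_sLin_sLin {a : V} (ha : a ≠ 0) (x y : V) :
    pairc (sLin a x) (sLin a y) = pairc x y := by
  simp only [pairc_eq, inner_sLin_sLin ha]

lemma pairc_sLin_self {a : V} (ha : a ≠ 0) (x : V) : pairc (sLin a x) a = -pairc x a := by
  rw [sLin_apply, pairc_sub, pairc_smul, pairc_self ha]; ring

lemma sLin_sLin_sLin {a : V} (ha : a ≠ 0) (b x : V) :
    sLin (sLin a b) (sLin a x) = sLin a (sLin b x) := by
  rw [sLin_apply (sLin a b), pairc_sLin_sLin ha, sLin_apply b, map_sub, map_smul]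

end Reflections

namespace RootSystemBase

variable {V : Type*} [NormedAddCommGroup V] [InnerProductSpace ℝ V] {r : ℕ}
  (R : RootSystemBase r V)

lemma α_ne_zero (j : Fin r) : R.α j ≠ 0 := R.ne_zero _ (R.simple_mem j)

lemma neg_mem_roots {a : V} (ha : a ∈ R.roots) : -a ∈ R.roots := by
  rw [← sLin_self (R.ne_zero a ha)]
  exact R.reflect_mem a ha a ha

/-- The simple roots as a basis. -/
def basis : Module.Basis (Fin r) ℝ V :=
  Module.Basis.mk R.simple_indep <| by
    rw [← R.span_top, Submodule.span_le]
    intro a ha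
    have hsum : ∀ c : Fin r → ℕ,
        ∑ i, (c i : ℝ) • R.α i ∈ Submodule.span ℝ (Set.range R.α) := fun c =>
      Submodule.sum_mem _ fun i _ =>
        Submodule.smul_mem _ _ (Submodule.subset_span ⟨i, rfl⟩)
    rcases R.pos_or_neg a ha with ⟨c, rfl⟩ | ⟨c, rfl⟩
    · exact hsum c
    · exact Submodule.neg_mem _ (hsum c)

@[simp] lemma basis_apply (j : Fin r) : R.basis j = R.α j := by simp [basis]

lemma repr_sum (c : Fin r → ℝ) (k : Fin r) : R.basis.repr (∑ i, c i • R.α i) k = c k := by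
  have : ∑ i, c i • R.α i = ∑ i, c i • R.basis i := by simp
  rw [this, R.basis.repr_sum_self]

lemma repr_α (j k : Fin r) : R.basis.repr (R.α j) k = if j = k then 1 else 0 := by
  rw [← R.basis_apply, R.basis.repr_self, Finsupp.single_apply]

lemma sum_repr_smul (x : V) : ∑ i, R.basis.repr x i • R.α i = x := by
  conv_rhs => rw [← R.basis.sum_repr x]
  simp

/-- Nonnegative real combinations of the simple roots. -/
def InCone (x : V) : Prop := ∀ k, 0 ≤ R.basis.repr x k

lemma inCone_sum_natCast (c : Fin r → ℕ) : R.InCone (∑ i, (c i : ℝ) • R.α i) := by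
  intro k
  rw [R.repr_sum (fun i => (c i : ℝ))]
  positivity

lemma inCone_of_mem_pos {a : V} (ha : a ∈ R.pos) : R.InCone a := by
  obtain ⟨-, c, rfl⟩ := ha
  exact R.inCone_sum_natCast c

lemma InCone.add {R : RootSystemBase r V} {x y : V} (hx : R.InCone x) (hy : R.InCone y) :
    R.InCone (x + y) := by
  intro k
  simpa using add_nonneg (hx k) (hy k)

lemma InCone.smul {R : RootSystemBase r V} {x : V} (hx : R.InCone x) {t : ℝ} (ht : 0 ≤ t) :
    R.InCone (t • x) := by
  intro k
  simpa using mul_nonneg ht (hx k)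

lemma eq_zero_of_inCone {x : V} (hx : R.InCone x) (hx' : R.InCone (-x)) : x = 0 := by
  apply R.basis.repr.injective
  ext k
  have h1 := hx k
  have h2 := hx' k
  simp at h2
  simp
  linarith

lemma pos_or_neg_mem_pos {a : V} (ha : a ∈ R.roots) : a ∈ R.pos ∨ -a ∈ R.pos := by
  rcases R.pos_or_neg a ha with h | ⟨c, hc⟩
  · exact .inl ⟨ha, h⟩
  · exact .inr ⟨R.neg_mem_roots ha, c, by rw [hc, neg_neg]⟩

lemma neg_notMem_pos {a : V} (ha : a ∈ R.pos) : -a ∉ R.pos := fun h =>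
  R.ne_zero a ha.1 (R.eq_zero_of_inCone (R.inCone_of_mem_pos ha) (R.inCone_of_mem_pos h))

lemma mem_pos_of_repr_pos {a : V} (ha : a ∈ R.roots) {k : Fin r}
    (hk : 0 < R.basis.repr a k) : a ∈ R.pos := by
  refine (R.pos_or_neg_mem_pos ha).resolve_right fun h => ?_
  have := R.inCone_of_mem_pos h k
  simp at this
  linarith

lemma α_mem_pos (j : Fin r) : R.α j ∈ R.pos :=
  R.mem_pos_of_repr_pos (R.simple_mem j) (k := j) (by simp [R.repr_α])

lemma sLin_α_mem_pos {a : V} (ha : a ∈ R.pos) {j : Fin r} (hj : a ≠ R.α j) :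
    sLin (R.α j) a ∈ R.pos := by
  by_cases h : ∃ k, k ≠ j ∧ R.basis.repr a k ≠ 0
  · obtain ⟨k, hk, hk0⟩ := h
    have h0 := lt_of_le_of_ne (R.inCone_of_mem_pos ha k) (Ne.symm hk0)
    refine R.mem_pos_of_repr_pos (R.reflect_mem _ (R.simple_mem j) _ ha.1) (k := k) ?_
    simp [sLin_apply, R.repr_α, Ne.symm hk, h0]
  · push Not at h
    exfalso
    have haj : a = R.basis.repr a j • R.α j := by
      conv_lhs => rw [← R.sum_repr_smul a]
      refine Finset.sum_eq_single j (fun k _ hk => by simp [h k hk]) (by simp)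
    have hmem : R.basis.repr a j • R.α j ∈ R.roots := haj ▸ ha.1
    rcases R.reduced _ (R.simple_mem j) _ hmem with h1 | h1
    · rw [h1, one_smul] at haj; exact hj haj
    · have := R.inCone_of_mem_pos ha j
      linarith

lemma sLin_mem_pos_ne {a : V} (ha : a ∈ R.pos) (j : Fin r) :
    sLin (R.α j) a ≠ R.α j := by
  intro h
  have h0 := R.α_ne_zero j
  have haj : a = -R.α j := by rw [← sLin_sLin h0 a, h, sLin_self h0]
  exact R.neg_notMem_pos (R.α_mem_pos j) (haj ▸ ha)

lemma inner_pos_pos_of_sLin_neg {a b : V} (ha : a ∈ R.pos) (hb : b ∈ R.pos)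
    (h : -sLin b a ∈ R.pos) : 0 < ⟪a, b⟫ := by
  by_contra hle
  have hp : pairc a b ≤ 0 := by
    rw [← not_lt, pairc_pos_iff a (R.ne_zero b hb.1)]; exact hle
  have hc : R.InCone (sLin b a) := by
    rw [sLin_apply, sub_eq_add_neg, ← neg_smul]
    exact (R.inCone_of_mem_pos ha).add ((R.inCone_of_mem_pos hb).smul (by linarith))
  exact R.ne_zero _ h.1 (by rw [R.eq_zero_of_inCone hc (R.inCone_of_mem_pos h), neg_zero])

/-- The positive roots with negative pairing with `x`. -/
def inv (x : V) : Set V := {a ∈ R.pos | ⟪x, a⟫ < 0}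

/-- The number of positive roots with negative pairing with `x`. -/
def len (x : V) : ℕ := (R.inv x).ncard

lemma finite_inv (x : V) : (R.inv x).Finite := R.finite.subset fun _ h => h.1.1

lemma len_lt_len_sLin {x b : V} (hb : b ∈ R.pos) (hx : 0 < ⟪x, b⟫) :
    R.len x < R.len (sLin b x) := by
  have hb0 := R.ne_zero b hb.1
  let φ : V → V := fun a => if sLin b a ∈ R.pos then sLin b a else a
  have hmaps : ∀ a ∈ R.inv x, φ a ∈ R.inv (sLin b x) := by
    rintro a ⟨ha, hax⟩
    by_cases h : sLin b a ∈ R.pos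
    · refine ⟨by simp [φ, h], ?_⟩
      simpa [φ, h, inner_sLin_sLin hb0] using hax
    · have h' := (R.pos_or_neg_mem_pos (R.reflect_mem b hb.1 a ha.1)).resolve_left h
      have hab := R.inner_pos_pos_of_sLin_neg ha hb h'
      have hφ : φ a = a := if_neg h
      rw [hφ]
      refine ⟨ha, ?_⟩
      have hp := (pairc_pos_iff x hb0).mpr hx
      rw [sLin_apply, inner_sub_left, real_inner_smul_left]
      rw [real_inner_comm] at hab
      have := mul_pos hp hab
      linarith
  have hinj : Set.InjOn φ (R.inv x) := by
    have key : ∀ a ∈ R.inv x, ∀ a' ∈ R.inv x, sLin b a ∈ R.pos → sLin b a' ∉ R.pos →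
        sLin b a ≠ a' := by
      rintro a ⟨ha, -⟩ a' - - h' rfl
      rw [sLin_sLin hb0] at h'
      exact h' ha
    intro a ha a' ha' h
    by_cases h1 : sLin b a ∈ R.pos <;> by_cases h2 : sLin b a' ∈ R.pos <;>
      simp only [φ, h1, h2, if_true, if_false] at h
    · rw [← sLin_sLin hb0 a, h, sLin_sLin hb0]
    · exact absurd h (key a ha a' ha' h1 h2)
    · exact absurd h.symm (key a' ha' a ha h2 h1)
    · exact h
  have hbmem : b ∈ R.inv (sLin b x) := by
    refine ⟨hb, ?_⟩
    rw [inner_sLin_left, sLin_self hb0, inner_neg_right]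
    linarith
  have hbimg : b ∉ φ '' R.inv x := by
    rintro ⟨a, ⟨ha, hax⟩, h⟩
    by_cases h1 : sLin b a ∈ R.pos <;> simp only [φ, h1, if_true, if_false] at h
    · have : a = -b := by rw [← sLin_sLin hb0 a, h, sLin_self hb0]
      rw [this] at ha
      exact R.neg_notMem_pos hb ha
    · rw [h] at hax; linarith
  calc R.len x = (φ '' R.inv x).ncard := hinj.ncard_image.symm
    _ < (R.inv (sLin b x)).ncard := by
      apply Set.ncard_lt_ncard _ (R.finite_inv _)
      refine ⟨?_, fun h => hbimg (h hbmem)⟩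
      rintro _ ⟨a, ha, rfl⟩
      exact hmaps a ha

lemma len_sLin_α {x : V} {j : Fin r} (hx : 0 < ⟪x, R.α j⟫) :
    R.len (sLin (R.α j) x) = R.len x + 1 := by
  have h0 := R.α_ne_zero j
  have hset : R.inv (sLin (R.α j) x) = insert (R.α j) (sLin (R.α j) '' R.inv x) := by
    ext a
    constructor
    · rintro ⟨ha, hax⟩
      by_cases haj : a = R.α j
      · exact .inl haj
      · refine .inr ⟨sLin (R.α j) a, ⟨R.sLin_α_mem_pos ha haj, ?_⟩, sLin_sLin h0 a⟩
        rwa [← inner_sLin_left]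
    · rintro (rfl | ⟨a, ⟨ha, hax⟩, rfl⟩)
      · refine ⟨R.α_mem_pos j, ?_⟩
        rw [inner_sLin_left, sLin_self h0, inner_neg_right]
        linarith
      · refine ⟨R.sLin_α_mem_pos ha (by rintro rfl; linarith), ?_⟩
        rwa [inner_sLin_sLin h0]
  have hnot : R.α j ∉ sLin (R.α j) '' R.inv x := by
    rintro ⟨a, ⟨ha, -⟩, h⟩
    exact R.sLin_mem_pos_ne ha j h
  rw [len, hset, Set.ncard_insert_of_notMem hnot ((R.finite_inv x).image _),
    Set.ncard_image_of_injective _ (Function.LeftInverse.injective (sLin_sLin h0)), len]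

/-! ### The Weyl group -/

/-- The simple reflection as a linear equivalence. -/
def simpleRefl (j : Fin r) : V ≃ₗ[ℝ] V :=
  LinearEquiv.ofInvolutive (sLin (R.α j)) (sLin_sLin (R.α_ne_zero j))

@[simp] lemma simpleRefl_apply (j : Fin r) (x : V) : R.simpleRefl j x = sLin (R.α j) x := rfl

lemma simpleRefl_mem_weyl (j : Fin r) : R.simpleRefl j ∈ R.weyl :=
  Subgroup.subset_closure ⟨j, fun _ => rfl⟩

lemma weyl_induction {P : (V ≃ₗ[ℝ] V) → Prop} (one : P 1)
    (mul : ∀ j g, P g → P (R.simpleRefl j * g)) {g : V ≃ₗ[ℝ] V} (hg : g ∈ R.weyl) : P g := by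
  have hgen : ∀ x : V ≃ₗ[ℝ] V, (∃ i : Fin r, ∀ y, x y = sLin (R.α i) y) →
      ∃ i, x = R.simpleRefl i ∧ x⁻¹ = R.simpleRefl i := by
    rintro x ⟨i, hi⟩
    obtain rfl : x = R.simpleRefl i := LinearEquiv.ext hi
    refine ⟨i, rfl, inv_eq_of_mul_eq_one_right ?_⟩
    ext y
    exact sLin_sLin (R.α_ne_zero i) y
  induction hg using Subgroup.closure_induction_left with
  | one => exact one
  | mul_left x hx y _ ih =>
    obtain ⟨i, hi, -⟩ := hgen x hx
    rw [hi]; exact mul i y ih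
  | inv_mul_cancel x hx y _ ih =>
    obtain ⟨i, -, hi⟩ := hgen x hx
    rw [hi]; exact mul i y ih

lemma inner_weyl {g : V ≃ₗ[ℝ] V} (hg : g ∈ R.weyl) (x y : V) : ⟪g x, g y⟫ = ⟪x, y⟫ := by
  refine R.weyl_induction (P := fun g => ⟪g x, g y⟫ = ⟪x, y⟫) rfl (fun j g ih => ?_) hg
  · simp only [LinearEquiv.mul_apply, simpleRefl_apply]
    rw [inner_sLin_sLin (R.α_ne_zero j), ih]

lemma weyl_mem_roots {g : V ≃ₗ[ℝ] V} (hg : g ∈ R.weyl) {a : V} (ha : a ∈ R.roots) :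
    g a ∈ R.roots := by
  exact R.weyl_induction (P := fun g => g a ∈ R.roots) ha
    (fun j g ih => R.reflect_mem _ (R.simple_mem j) _ ih) hg

lemma inner_weyl_symm {g : V ≃ₗ[ℝ] V} (hg : g ∈ R.weyl) (x y : V) :
    ⟪g x, y⟫ = ⟪x, g⁻¹ y⟫ := by
  rw [← R.inner_weyl hg x (g⁻¹ y)]
  congr 1
  exact (LinearEquiv.apply_symm_apply g y).symm

lemma orbit_induction {μ : V} {P : V → Prop} (base : P μ)
    (step : ∀ x j, P x → P (sLin (R.α j) x)) {y : V} (hy : y ∈ R.orbit μ) : P y := by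
  obtain ⟨g, hg, rfl⟩ := hy
  exact R.weyl_induction (P := fun g => P (g μ)) base (fun j g ih => step _ j ih) hg

lemma self_mem_orbit (μ : V) : μ ∈ R.orbit μ := ⟨1, R.weyl.one_mem, rfl⟩

lemma weyl_mem_orbit {μ y : V} (hy : y ∈ R.orbit μ) {g : V ≃ₗ[ℝ] V} (hg : g ∈ R.weyl) :
    g y ∈ R.orbit μ := by
  obtain ⟨h, hh, rfl⟩ := hy
  exact ⟨g * h, R.weyl.mul_mem hg hh, rfl⟩

lemma sLin_α_mem_orbit {μ y : V} (hy : y ∈ R.orbit μ) (j : Fin r) :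
    sLin (R.α j) y ∈ R.orbit μ := R.weyl_mem_orbit hy (R.simpleRefl_mem_weyl j)

/-- Dominant vectors. -/
def Dominant (x : V) : Prop := ∀ j, 0 ≤ ⟪x, R.α j⟫

lemma inner_nonneg_of_inCone {x y : V} (hx : R.Dominant x) (hy : R.InCone y) :
    0 ≤ ⟪x, y⟫ := by
  rw [← R.sum_repr_smul y, inner_sum]
  refine Finset.sum_nonneg fun i _ => ?_
  rw [real_inner_smul_right]
  exact mul_nonneg (hy i) (hx i)

lemma exists_weyl_dominant (x : V) : ∃ g ∈ R.weyl, R.Dominant (g x) := by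
  induction hn : R.len x using Nat.strong_induction_on generalizing x with
  | _ n ih =>
    by_cases hx : R.Dominant x
    · exact ⟨1, R.weyl.one_mem, hx⟩
    · simp only [Dominant, not_forall, not_le] at hx
      obtain ⟨j, hj⟩ := hx
      have h0 := R.α_ne_zero j
      have hpos : 0 < ⟪sLin (R.α j) x, R.α j⟫ := by
        rw [inner_sLin_left, sLin_self h0, inner_neg_right]; linarith
      have hlen := R.len_sLin_α hpos
      rw [sLin_sLin h0, hn] at hlen
      obtain ⟨g, hg, hd⟩ := ih (R.len (sLin (R.α j) x)) (by omega) _ rfl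
      exact ⟨g * R.simpleRefl j, R.weyl.mul_mem hg (R.simpleRefl_mem_weyl j), hd⟩

/-- Reachability by successive reflections in positive roots that lower the vector. -/
def Below : V → V → Prop :=
  Relation.ReflTransGen fun x y => ∃ b ∈ R.pos, 0 < ⟪x, b⟫ ∧ y = sLin b x

lemma below_sLin_α {μ y : V} (hμ : R.Dominant μ) (h : R.Below μ y) (j : Fin r) :
    R.Below μ (sLin (R.α j) y) := by
  have h0 := R.α_ne_zero j
  induction h with
  | refl =>
    rcases (hμ j).eq_or_lt with h | h
    · have : sLin (R.α j) μ = μ := by simp [sLin_apply, pairc_eq, ← h]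
      rw [this]
      exact .refl
    · exact .single ⟨_, R.α_mem_pos j, h, rfl⟩
  | @tail x y hx hxy ih =>
    obtain ⟨b, hb, hpos, rfl⟩ := hxy
    by_cases hbj : b = R.α j
    · rw [hbj, sLin_sLin h0]; exact hx
    · refine ih.tail ⟨sLin (R.α j) b, R.sLin_α_mem_pos hb hbj, ?_, ?_⟩
      · rwa [inner_sLin_sLin h0]
      · rw [sLin_sLin_sLin h0]

lemma inCone_sub_of_mem_orbit {μ y : V} (hμ : R.Dominant μ) (hy : y ∈ R.orbit μ) :
    R.InCone (μ - y) := by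
  have h : R.Below μ y := R.orbit_induction (P := R.Below μ) .refl
    (fun x j hx => R.below_sLin_α hμ hx j) hy
  clear hy
  induction h with
  | refl => intro k; simp
  | @tail x y _ hxy ih =>
    obtain ⟨b, hb, hpos, rfl⟩ := hxy
    have : μ - sLin b x = (μ - x) + pairc x b • b := by rw [sLin_apply]; abel
    rw [this]
    exact InCone.add (ih) ((R.inCone_of_mem_pos hb).smul
      ((pairc_pos_iff x (R.ne_zero b hb.1)).mpr hpos).le)

end RootSystemBase

namespace RootSystemBase

variable {V : Type*} [NormedAddCommGroup V] [InnerProductSpace ℝ V] {r : ℕ}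
  (R : RootSystemBase r V)

lemma eq_of_mem_orbit_of_dominant {μ y : V} (hμ : R.Dominant μ) (hy : R.Dominant y)
    (hmem : y ∈ R.orbit μ) : y = μ := by
  have hmem' : μ ∈ R.orbit y := by
    obtain ⟨g, hg, rfl⟩ := hmem
    exact ⟨g⁻¹, R.weyl.inv_mem hg, (LinearEquiv.symm_apply_apply g μ).symm⟩
  have h := R.eq_zero_of_inCone (R.inCone_sub_of_mem_orbit hμ hmem)
    (by rw [neg_sub]; exact R.inCone_sub_of_mem_orbit hy hmem')
  exact (sub_eq_zero.mp h).symm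

lemma exists_inner_α_eq_one : ∃ ρ : V, ∀ j, ⟪ρ, R.α j⟫ = (1 : ℝ) := by
  have : FiniteDimensional ℝ V := R.basis.finiteDimensional_of_finite
  refine ⟨(InnerProductSpace.toDual ℝ V).symm
    (LinearMap.toContinuousLinearMap (R.basis.constr ℝ fun _ => (1 : ℝ))), fun j => ?_⟩
  rw [InnerProductSpace.toDual_symm_apply, ← R.basis_apply]
  simp only [LinearMap.coe_toContinuousLinearMap', Module.Basis.constr_basis]

lemma ext_inner_α {x y : V} (h : ∀ j, ⟪x, R.α j⟫ = (⟪y, R.α j⟫ : ℝ)) : x = y := by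
  have hz : ∀ z : V, ⟪x - y, z⟫ = (0 : ℝ) := fun z => by
    rw [← R.sum_repr_smul z, inner_sum]
    exact Finset.sum_eq_zero fun j _ => by
      rw [real_inner_smul_right, inner_sub_left, h j, sub_self, mul_zero]
  exact sub_eq_zero.mp (inner_self_eq_zero.mp (hz _))

variable {R}

lemma dominant_highestRoot {θ : V} (hθ : R.IsHighestRoot θ) : R.Dominant θ := by
  intro j
  obtain ⟨c, hc⟩ := hθ.2 _ (R.reflect_mem _ (R.simple_mem j) _ hθ.1.1)
  have h := R.inCone_sum_natCast c j
  rw [← hc, sLin_apply] at h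
  rw [← pairc_nonneg_iff _ (R.α_ne_zero j)]
  simpa [R.repr_α] using h

lemma inner_self_le_highestRoot {θ : V} (hθ : R.IsHighestRoot θ) {β : V} (hβ : β ∈ R.roots) :
    (⟪β, β⟫ : ℝ) ≤ ⟪θ, θ⟫ := by
  obtain ⟨g, hg, hd⟩ := R.exists_weyl_dominant β
  obtain ⟨c, hc⟩ := hθ.2 _ (R.weyl_mem_roots hg hβ)
  have hcone : R.InCone (θ - g β) := hc ▸ R.inCone_sum_natCast c
  have h1 := R.inner_nonneg_of_inCone (dominant_highestRoot hθ) hcone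
  have h2 := R.inner_nonneg_of_inCone hd hcone
  rw [inner_sub_right] at h1 h2
  rw [real_inner_comm θ (g β)] at h2
  rw [← R.inner_weyl hg β β]
  linarith

lemma exists_long_inner_pos {θ : V} (hθ : R.IsHighestRoot θ) {β : V} (hβ : β ∈ R.roots) :
    ∃ δ ∈ R.roots, ⟪δ, δ⟫ = (⟪θ, θ⟫ : ℝ) ∧ (0 : ℝ) < ⟪δ, β⟫ := by
  let S : Set V :=
    {b ∈ R.roots | ∃ δ ∈ R.roots, ⟪δ, δ⟫ = (⟪θ, θ⟫ : ℝ) ∧ (⟪δ, b⟫ : ℝ) ≠ 0}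
  let T : Set V := {b ∈ R.roots | b ∉ S}
  have hST : R.roots = S ∪ T := by
    ext b
    simp only [T, S, Set.mem_union, Set.mem_ofPred_eq]
    tauto
  have horth : ∀ a ∈ S, ∀ b ∈ T, (⟪a, b⟫ : ℝ) = 0 := by
    rintro a ⟨ha, δ, hδ, hδθ, hδa⟩ b ⟨hb, hbS⟩
    by_contra hab
    have ha0 := R.ne_zero a ha
    have hδb : (⟪δ, b⟫ : ℝ) = 0 := by
      by_contra h
      exact hbS ⟨hb, δ, hδ, hδθ, h⟩
    refine hbS ⟨hb, sLin a δ, R.reflect_mem _ ha _ hδ, by rw [inner_sLin_sLin ha0, hδθ], ?_⟩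
    rw [sLin_apply, inner_sub_left, hδb, real_inner_smul_left, zero_sub, neg_ne_zero]
    refine mul_ne_zero (fun h => hδa ?_) hab
    have := pairc_mul δ ha0
    rw [h] at this
    linarith
  have hθS : θ ∈ S :=
    ⟨hθ.1.1, θ, hθ.1.1, rfl, inner_self_ne_zero.mpr (R.ne_zero _ hθ.1.1)⟩
  have hT : T = ∅ := (R.irred S T hST horth).resolve_left fun h => by simp [h] at hθS
  have hβS : β ∈ S := by
    rw [hST, hT, Set.union_empty] at hβ
    exact hβ
  obtain ⟨-, δ, hδ, hδθ, hδβ⟩ := hβS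
  rcases lt_or_gt_of_ne hδβ with h | h
  · exact ⟨-δ, R.neg_mem_roots hδ, by simpa using hδθ, by rw [inner_neg_left]; linarith⟩
  · exact ⟨δ, hδ, hδθ, h⟩

variable (R) in
/-- A dominant weight `μ` whose inner products with the positive roots are `0` or `t`, where
`2t` is the squared length of the long roots. -/
structure IsMinWeight (t : ℝ) (μ : V) : Prop where
  pos : 0 < t
  norm_le : ∀ β ∈ R.roots, (⟪β, β⟫ : ℝ) ≤ 2 * t
  long : ∀ β ∈ R.roots, ∃ δ ∈ R.roots, ⟪δ, δ⟫ = 2 * t ∧ (0 : ℝ) < ⟪δ, β⟫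
  inner_eq : ∀ γ ∈ R.pos, ⟪μ, γ⟫ = (0 : ℝ) ∨ ⟪μ, γ⟫ = t

lemma isLong_of_minuscule {i : Fin r} {c : V} (hc : R.IsFundCoweight i c)
    (hmin : R.IsMinusculeCoweight c) {θ : V} (hθ : R.IsHighestRoot θ) :
    ⟪R.α i, R.α i⟫ = (⟪θ, θ⟫ : ℝ) := by
  obtain ⟨δ, hδ, hδθ, hpos⟩ := exists_long_inner_pos hθ (R.simple_mem i)
  have hα := inner_self_pos_of_ne_zero (R.α_ne_zero i)
  have hδ0 := R.ne_zero _ hδ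
  have hroot : ∀ a ∈ R.roots, (⟪a, c⟫ : ℝ) ≤ 1 ∧ -1 ≤ (⟪a, c⟫ : ℝ) := by
    intro a ha
    rcases R.pos_or_neg_mem_pos ha with h | h
    · rcases hmin _ h with h | h <;> rw [h] <;> norm_num
    · have := hmin _ h
      rw [inner_neg_left] at this
      constructor <;> rcases this with h | h <;> linarith
  have hle := inner_self_le_highestRoot hθ (R.simple_mem i)
  by_contra hne
  have hlt := lt_of_le_of_ne hle hne
  obtain ⟨m, hm⟩ := R.cryst _ (R.simple_mem i) _ hδ
  obtain ⟨n, hn⟩ := R.cryst _ hδ _ (R.simple_mem i)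
  have hm1 := pairc_mul δ (R.α_ne_zero i)
  have hn1 := pairc_mul (R.α i) hδ0
  rw [real_inner_comm δ (R.α i), hδθ] at hn1
  have hn0 : 0 < pairc (R.α i) δ := by
    rw [pairc_pos_iff _ hδ0, real_inner_comm]; exact hpos
  have hmn : pairc (R.α i) δ < pairc δ (R.α i) := by nlinarith
  rw [hm, hn] at hmn
  rw [hn] at hn0
  norm_cast at hmn hn0
  have hm2 : (2 : ℝ) ≤ m := by
    have : 2 ≤ m := by omega
    exact_mod_cast this
  have h1 := hroot _ hδ
  have hδ' := R.reflect_mem _ (R.simple_mem i) _ hδ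
  have h2 := hroot _ hδ'
  rw [sLin_apply, inner_sub_left, real_inner_smul_left, hc i, if_pos rfl, hm] at h2
  have hm_eq : (m : ℝ) = 2 := by linarith [h1.1, h2.2]
  have hδc : (⟪δ, c⟫ : ℝ) = 1 := by linarith [h1.1, h2.2]
  have hδpos : δ ∈ R.pos := (R.pos_or_neg_mem_pos hδ).resolve_right fun h => by
    have := hmin _ h
    rw [inner_neg_left, hδc] at this
    norm_num at this
  have hδ'pos : -sLin (R.α i) δ ∈ R.pos := (R.pos_or_neg_mem_pos hδ').resolve_left fun h => by
    have := hmin _ h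
    rw [sLin_apply, inner_sub_left, real_inner_smul_left, hc i, if_pos rfl, hm, hδc, hm_eq] at this
    norm_num at this
  have hδα : δ = R.basis.repr δ i • R.α i := by
    conv_lhs => rw [← R.sum_repr_smul δ]
    refine Finset.sum_eq_single i (fun k _ hk => ?_) (by simp)
    have h1 := R.inCone_of_mem_pos hδpos k
    have h2 := R.inCone_of_mem_pos hδ'pos k
    simp [sLin_apply, R.repr_α, Ne.symm hk] at h2
    rw [le_antisymm h2 h1, zero_smul]
  have h3 := hδc
  rw [hδα, real_inner_smul_left, hc i, if_pos rfl, mul_one] at h3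
  rw [h3, one_smul] at hδα
  rw [hδα] at hδθ
  exact hne hδθ

lemma fundWeight_eq_smul {i : Fin r} {c ϖ : V} (hc : R.IsFundCoweight i c)
    (hmin : R.IsMinusculeCoweight c) (hϖ : R.IsFundWeight i ϖ) {θ : V}
    (hθ : R.IsHighestRoot θ) : ϖ = (⟪θ, θ⟫ / 2 : ℝ) • c := by
  refine R.ext_inner_α fun j => ?_
  have h1 := pairc_mul ϖ (R.α_ne_zero j)
  rw [hϖ j] at h1
  rw [real_inner_smul_left, real_inner_comm (R.α j) c, hc j]
  split_ifs at h1 ⊢ with h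
  · subst h
    rw [← isLong_of_minuscule hc hmin hθ]; linarith
  · linarith

lemma isMinWeight_neg_longest {θ : V} (hθ : R.IsHighestRoot θ) {i : Fin r} {c ϖ : V}
    (hc : R.IsFundCoweight i c) (hmin : R.IsMinusculeCoweight c) (hϖ : R.IsFundWeight i ϖ)
    {w₀ : V ≃ₗ[ℝ] V} (hw₀ : R.IsLongest w₀) :
    R.IsMinWeight (⟪θ, θ⟫ / 2) (-(w₀ ϖ)) where
  pos := half_pos (inner_self_pos_of_ne_zero (R.ne_zero _ hθ.1.1))
  norm_le β hβ := by rw [mul_div_cancel₀ _ two_ne_zero]; exact inner_self_le_highestRoot hθ hβ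
  long β hβ := by rw [mul_div_cancel₀ _ two_ne_zero]; exact exists_long_inner_pos hθ hβ
  inner_eq γ hγ := by
    have hmem : w₀⁻¹ γ ∈ R.roots := R.weyl_mem_roots (R.weyl.inv_mem hw₀.1) hγ.1
    have hpos : -(w₀⁻¹ γ) ∈ R.pos := (R.pos_or_neg_mem_pos hmem).resolve_left fun h => by
      have h' := hw₀.2 _ h
      rw [show w₀ (w₀⁻¹ γ) = γ from LinearEquiv.apply_symm_apply w₀ γ] at h'
      exact R.neg_notMem_pos hγ h'
    rw [inner_neg_left, R.inner_weyl_symm hw₀.1, ← inner_neg_right,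
      fundWeight_eq_smul hc hmin hϖ hθ, real_inner_smul_left, real_inner_comm (-(w₀⁻¹ γ)) c]
    rcases hmin _ hpos with h | h <;> rw [h] <;> simp

namespace IsMinWeight

variable {t : ℝ} {μ : V}

lemma dominant (hμ : R.IsMinWeight t μ) : R.Dominant μ := fun j => by
  rcases hμ.inner_eq _ (R.α_mem_pos j) with h | h <;> rw [h]
  exact hμ.pos.le

lemma inner_orbit (hμ : R.IsMinWeight t μ) {y : V} (hy : y ∈ R.orbit μ) {β : V}
    (hβ : β ∈ R.roots) :
    ⟪y, β⟫ = -t ∨ ⟪y, β⟫ = (0 : ℝ) ∨ ⟪y, β⟫ = t := by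
  obtain ⟨g, hg, rfl⟩ := hy
  rw [R.inner_weyl_symm hg]
  rcases R.pos_or_neg_mem_pos (R.weyl_mem_roots (R.weyl.inv_mem hg) hβ) with h | h
  · exact .inr (hμ.inner_eq _ h)
  · have := hμ.inner_eq _ h
    rw [inner_neg_right] at this
    rcases this with h | h
    · exact .inr (.inl (by linarith))
    · exact .inl (by linarith)

lemma inner_orbit_neg (hμ : R.IsMinWeight t μ) {y : V} (hy : y ∈ R.orbit μ) {β : V}
    (hβ : β ∈ R.roots) (h : (⟪y, β⟫ : ℝ) < 0) : ⟪y, β⟫ = -t := by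
  have := hμ.pos
  rcases hμ.inner_orbit hy hβ with h' | h' | h' <;> first | exact h' | linarith

lemma exists_norm_mul (hμ : R.IsMinWeight t μ) {β : V} (hβ : β ∈ R.roots) :
    ∃ n : ℕ, 0 < n ∧ 2 * t = n * ⟪β, β⟫ := by
  obtain ⟨δ, hδ, hδt, hpos⟩ := hμ.long β hβ
  have hβ0 := R.ne_zero _ hβ
  have hδ0 := R.ne_zero _ hδ
  have hβpos := inner_self_pos_of_ne_zero hβ0
  obtain ⟨m, hm⟩ := R.cryst _ hβ _ hδ
  obtain ⟨n, hn⟩ := R.cryst _ hδ _ hβ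
  have hm1 := pairc_mul δ hβ0
  have hn1 := pairc_mul β hδ0
  rw [real_inner_comm δ β, hδt, hn] at hn1
  rw [hm] at hm1
  have ht := hμ.pos
  have hle := hμ.norm_le β hβ
  have hn0 : (0 : ℝ) < n := by
    by_contra h
    nlinarith
  have hm0 : (0 : ℝ) < m := by
    by_contra h
    nlinarith
  have hnm : (n : ℝ) ≤ m := by
    by_contra h
    nlinarith
  have hcs : (n : ℝ) * m ≤ 4 := by
    have h := real_inner_mul_inner_self_le δ β
    rw [hδt] at h
    have h2 : (n * m : ℝ) * (2 * t * ⟪β, β⟫) = 4 * (⟪δ, β⟫ * ⟪δ, β⟫) := by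
      calc (n * m : ℝ) * (2 * t * ⟪β, β⟫) = (n * (2 * t)) * (m * ⟪β, β⟫) := by ring
        _ = _ := by rw [hn1, hm1]; ring
    have h3 : (0 : ℝ) < 2 * t * ⟪β, β⟫ := by positivity
    by_contra h4
    nlinarith
  have heq : (n : ℝ) * (2 * t) = m * ⟪β, β⟫ := by rw [hn1, hm1]
  norm_cast at hn0 hm0 hnm hcs
  rcases eq_or_lt_of_le (show 1 ≤ n by omega) with h | h
  · refine ⟨m.toNat, by omega, ?_⟩
    have hcast : ((m.toNat : ℕ) : ℝ) = m := by
      exact_mod_cast (Int.toNat_of_nonneg hm0.le)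
    rw [hcast, ← heq, ← h]; simp
  · obtain rfl : n = m := by nlinarith
    refine ⟨1, one_pos, ?_⟩
    have : (n : ℝ) ≠ 0 := by exact_mod_cast hn0.ne'
    rw [Nat.cast_one, one_mul]
    exact mul_left_cancel₀ this heq

lemma pairc_orbit (hμ : R.IsMinWeight t μ) {y : V} (hy : y ∈ R.orbit μ) {β : V}
    (hβ : β ∈ R.roots) :
    ∃ n : ℤ, pairc y β = n := by
  obtain ⟨n, -, hn⟩ := hμ.exists_norm_mul hβ
  have hβ0 := (inner_self_pos_of_ne_zero (R.ne_zero _ hβ)).ne'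
  have hval : 2 * t / ⟪β, β⟫ = n := by rw [hn, mul_div_cancel_right₀ _ hβ0]
  rcases hμ.inner_orbit hy hβ with h | h | h <;> rw [pairc_eq, h]
  · refine ⟨-n, ?_⟩
    rw [mul_neg, neg_div, hval]; simp
  · exact ⟨0, by simp⟩
  · exact ⟨n, by rw [hval]; simp⟩

end IsMinWeight
end RootSystemBase

namespace RootSystemBase

variable {V : Type*} [NormedAddCommGroup V] [InnerProductSpace ℝ V] {r : ℕ}
  (R : RootSystemBase r V)

/-- A covering relation in the orbit order, by a reflection satisfying the integrality
condition of Lakshmibai–Seshadri chains at time `a`. -/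
def Step (a : ℝ) (x y : V) : Prop :=
  ∃ β ∈ R.pos, 0 < (⟪x, β⟫ : ℝ) ∧ y = sLin β x ∧ (∃ n : ℤ, a * pairc x β = n) ∧
    R.len y = R.len x + 1

/-- The chains of Lakshmibai–Seshadri at time `a`. -/
def AChain (a : ℝ) : V → V → Prop := Relation.ReflTransGen (R.Step a)

/-- `R.Seg μ b y a x L`: the steps in `L` form a piece of a Lakshmibai–Seshadri path of shape
`μ`, running from time `a` to time `b`, entered with direction `x` and left with direction
`y`. -/
inductive Seg (μ : V) (b : ℝ) (y : V) : ℝ → V → List (V × ℝ) → Prop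
  | nil : Seg μ b y b y []
  | zero {a x L} : Seg μ b y a x L → Seg μ b y a x (0 :: L)
  | cons {a x L} (c : ℝ) (z : V) : 0 < c → z ∈ R.orbit μ → R.AChain a z x →
      Seg μ b y (a + c) z L → Seg μ b y a x ((c • z, 0) :: L)

/-- The finite simple root operator at node `j`, at level zero. -/
abbrev finOp (j : Fin r) : RootOp (V × ℝ) := ⟨(R.α j, 0), affCovF (R.α j)⟩

variable {R}

lemma finOp_cov (j : Fin r) (x : V × ℝ) : (R.finOp j).cov x = pairc x.1 (R.α j) := by
  simp [affCovF, pairc, real_inner_comm]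

lemma finOp_s (j : Fin r) (c : ℝ) (x : V) :
    (R.finOp j).s (c • x, 0) = (c • sLin (R.α j) x, 0) := by
  rw [RootOp.s, finOp_cov, pairc_smul, sLin_apply, smul_sub, smul_smul]
  simp

lemma Step.not_pos {a : ℝ} {x y : V} {j : Fin r} (h : R.Step a x y) (hx : 0 < (⟪x, R.α j⟫ : ℝ))
    (hy : (⟪y, R.α j⟫ : ℝ) ≤ 0) :
    y = sLin (R.α j) x ∧ ∃ n : ℤ, a * pairc x (R.α j) = n := by
  obtain ⟨β, hβ, hβx, rfl, hint, hlen⟩ := h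
  have h0 := R.α_ne_zero j
  by_cases hβj : β = R.α j
  · subst hβj; exact ⟨rfl, hint⟩
  exfalso
  have h1 := R.len_lt_len_sLin (x := sLin (R.α j) x) (R.sLin_α_mem_pos hβ hβj)
    (by rwa [inner_sLin_sLin h0])
  rw [sLin_sLin_sLin h0, R.len_sLin_α hx] at h1
  rcases hy.lt_or_eq with hy | hy
  · have h2 := R.len_sLin_α (x := sLin (R.α j) (sLin β x)) (j := j)
      (by rw [inner_sLin_left, sLin_self h0, inner_neg_right]; linarith)
    rw [sLin_sLin h0] at h2
    omega
  · have h2 : sLin (R.α j) (sLin β x) = sLin β x := by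
      rw [sLin_apply, pairc_eq, hy]; simp
    rw [h2] at h1
    omega

lemma Step.sLin_α {a : ℝ} {x y : V} {j : Fin r} (h : R.Step a x y)
    (hx : 0 < (⟪x, R.α j⟫ : ℝ)) (hy : 0 < (⟪y, R.α j⟫ : ℝ)) :
    R.Step a (sLin (R.α j) x) (sLin (R.α j) y) := by
  obtain ⟨β, hβ, hβx, rfl, hint, hlen⟩ := h
  have h0 := R.α_ne_zero j
  have hβj : β ≠ R.α j := by
    rintro rfl
    rw [inner_sLin_left, sLin_self h0, inner_neg_right] at hy
    linarith
  refine ⟨sLin (R.α j) β, R.sLin_α_mem_pos hβ hβj, ?_, ?_, ?_, ?_⟩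
  · rwa [inner_sLin_sLin h0]
  · rw [sLin_sLin_sLin h0]
  · rwa [pairc_sLin_sLin h0]
  · rw [R.len_sLin_α hx, R.len_sLin_α hy, hlen]

namespace AChain

lemma exists_sub_eq {a : ℝ} {z x : V} (h : R.AChain a z x) (j : Fin r) :
    ∃ n : ℤ, a * pairc z (R.α j) - a * pairc x (R.α j) = n := by
  induction h with
  | refl => exact ⟨0, by simp⟩
  | @tail x y _ hxy ih =>
    obtain ⟨n, hn⟩ := ih
    obtain ⟨β, hβ, -, rfl, ⟨m, hm⟩, -⟩ := hxy
    obtain ⟨k, hk⟩ := R.cryst _ (R.simple_mem j) _ hβ.1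
    refine ⟨n + m * k, ?_⟩
    rw [sLin_apply, pairc_sub, pairc_smul]
    push_cast
    rw [← hn, ← hm, ← hk]; ring

/-- A chain starting on the positive side of a simple root either stays liftable to the
reflected chain, or crosses the wall at an integral time. -/
lemma reflect {a : ℝ} {z x : V} {j : Fin r} (h : R.AChain a z x)
    (hz : 0 < (⟪z, R.α j⟫ : ℝ)) :
    (0 < (⟪x, R.α j⟫ : ℝ) ∧ R.AChain a (sLin (R.α j) z) (sLin (R.α j) x)) ∨
      (R.AChain a (sLin (R.α j) z) x ∧ ∃ n : ℤ, a * pairc z (R.α j) = n) := by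
  induction h with
  | refl => exact .inl ⟨hz, .refl⟩
  | @tail x y hx hxy ih =>
    rcases ih with ⟨hpos, hch⟩ | ⟨hch, hint⟩
    · by_cases hy : 0 < (⟪y, R.α j⟫ : ℝ)
      · exact .inl ⟨hy, hch.tail (hxy.sLin_α hpos hy)⟩
      · obtain ⟨rfl, n, hn⟩ := hxy.not_pos hpos (not_lt.mp hy)
        obtain ⟨m, hm⟩ := AChain.exists_sub_eq hx j
        refine .inr ⟨hch, m + n, ?_⟩
        push_cast
        rw [← hn, ← hm]; ring
    · exact .inr ⟨hch.tail hxy, hint⟩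

end AChain

namespace Seg

variable {μ : V} {a b : ℝ} {x y : V} {L : List (V × ℝ)}

lemma le (h : R.Seg μ b y a x L) : a ≤ b := by
  induction h with
  | nil => exact le_rfl
  | zero _ ih => exact ih
  | cons c _ hc _ _ _ ih => linarith

lemma snd_eq_zero (h : R.Seg μ b y a x L) : ∀ w ∈ L, w.2 = 0 := by
  induction h with
  | nil => simp
  | zero _ ih => simpa using ih
  | cons c _ _ _ _ _ ih => simpa using ih

lemma exists_append {A B : List (V × ℝ)} (h : R.Seg μ b y a x (A ++ B)) :
    ∃ m z, R.Seg μ m z a x A ∧ R.Seg μ b y m z B := by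
  induction A generalizing a x with
  | nil => exact ⟨a, x, .nil, h⟩
  | cons w A ih =>
    rw [List.cons_append] at h
    cases h with
    | zero h =>
      obtain ⟨m, z, h1, h2⟩ := ih h
      exact ⟨m, z, .zero h1, h2⟩
    | cons c z hc hz hch h =>
      obtain ⟨m, z', h1, h2⟩ := ih h
      exact ⟨m, z', .cons c z hc hz hch h1, h2⟩

lemma append {m : ℝ} {z : V} {A B : List (V × ℝ)} (h : R.Seg μ m z a x A)
    (h' : R.Seg μ b y m z B) : R.Seg μ b y a x (A ++ B) := by
  induction h with
  | nil => exact h'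
  | zero _ ih => exact .zero ih
  | cons c z hc hz hch _ ih => exact .cons c z hc hz hch ih

lemma exists_of_aChain (h : R.Seg μ b y a x L) {x' : V} (hx : R.AChain a x x') :
    ∃ y', R.Seg μ b y' a x' L := by
  induction h with
  | nil => exact ⟨x', .nil⟩
  | zero _ ih =>
    obtain ⟨y', h⟩ := ih hx
    exact ⟨y', .zero h⟩
  | cons c z hc hz hch h => exact ⟨y, .cons c z hc hz (hch.trans hx) h⟩

lemma exists_cov_sum_eq (h : R.Seg μ b y a x L) (j : Fin r) :
    ∃ n : ℤ, (R.finOp j).cov L.sum = b * pairc y (R.α j) - a * pairc x (R.α j) + n := by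
  induction h with
  | nil => exact ⟨0, by simp⟩
  | zero _ ih => simpa using ih
  | @cons a x L c z hc hz hch _ ih =>
    obtain ⟨n, hn⟩ := ih
    obtain ⟨m, hm⟩ := hch.exists_sub_eq j
    refine ⟨n - m, ?_⟩
    rw [List.sum_cons, map_add, hn, finOp_cov, pairc_smul]
    push_cast
    rw [← hm]; ring

lemma eq_or_nonpos (h : R.Seg μ b y a x L) {j : Fin r}
    (hL : ∀ A B, L = A ++ B → (R.finOp j).cov B.sum ≤ 0) :
    (b = a ∧ y = x ∧ L.sum = 0 ∧ ∀ X, R.Seg μ a X a X L) ∨ pairc y (R.α j) ≤ 0 := by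
  induction h with
  | nil => exact .inl ⟨rfl, rfl, rfl, fun _ => .nil⟩
  | @zero a x L _ ih =>
    rcases ih fun A B hAB => hL (0 :: A) B (by rw [hAB]; rfl) with ⟨h1, h2, h3, h4⟩ | h
    · exact .inl ⟨h1, h2, by simpa using h3, fun X => .zero (h4 X)⟩
    · exact .inr h
  | @cons a x L c z hc hz hch _ ih =>
    right
    rcases ih fun A B hAB => hL ((c • z, 0) :: A) B (by rw [hAB]; rfl) with ⟨h1, h2, h3, h4⟩ | h
    · have := hL [] _ rfl
      rw [List.sum_cons, h3, add_zero, finOp_cov, pairc_smul] at this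
      rw [h2]
      by_contra hlt
      have := mul_pos hc (not_le.mp hlt)
      linarith
    · exact h

lemma map_s (h : R.Seg μ b y a x L) {j : Fin r} (hy : 0 < (⟪y, R.α j⟫ : ℝ))
    (hL : ∀ A B, L = A ++ B → B ≠ [] →
      ∀ n : ℤ, a * pairc x (R.α j) + (R.finOp j).cov A.sum ≠ n) :
    R.Seg μ b (sLin (R.α j) y) a (sLin (R.α j) x) (L.map (R.finOp j).s) ∧
      0 < (⟪x, R.α j⟫ : ℝ) := by
  induction h with
  | nil => exact ⟨.nil, hy⟩
  | @zero a x L _ ih =>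
    obtain ⟨h1, h2⟩ := ih fun A B hAB hB n hn =>
      hL (0 :: A) B (by rw [hAB]; rfl) hB n (by simpa using hn)
    refine ⟨?_, h2⟩
    have : (R.finOp j).s 0 = 0 := by simp [RootOp.s]
    rw [List.map_cons, this]
    exact .zero h1
  | @cons a x L c z hc hz hch _ ih =>
    obtain ⟨m, hm⟩ := hch.exists_sub_eq j
    obtain ⟨h1, h2⟩ := ih fun A B hAB hB n hn =>
      hL ((c • z, 0) :: A) B (by rw [hAB]; rfl) hB (n - m) (by
        rw [List.sum_cons, map_add, finOp_cov, pairc_smul]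
        push_cast
        rw [← hn, ← hm]; ring)
    rcases hch.reflect h2 with ⟨h3, h4⟩ | ⟨-, n, hn⟩
    · refine ⟨?_, h3⟩
      rw [List.map_cons, finOp_s]
      exact .cons c _ hc (R.sLin_α_mem_orbit hz j) h4 h1
    · refine absurd ?_ (hL [] _ rfl (by simp) (n - m))
      push_cast
      rw [← hn, ← hm]
      simp

/-- Cutting the first step of a segment. -/
lemma cut {c : ℝ} {z : V} (hc : 0 < c) (hz : z ∈ R.orbit μ) (hch : R.AChain a z x)
    (h : R.Seg μ b y (a + c) z L) {s : ℝ} (hs : 0 < s) (hs1 : s ≤ 1) :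
    R.Seg μ (a + s * c) z a x [s • (c • z, 0)] ∧
      R.Seg μ b y (a + s * c) z ((1 - s) • (c • z, 0) :: L) := by
  have hsmul : ∀ u : ℝ, u • ((c • z, 0) : V × ℝ) = ((u * c) • z, 0) := fun u => by
    simp [smul_smul]
  constructor
  · rw [hsmul]
    exact .cons _ z (mul_pos hs hc) hz hch .nil
  · rcases hs1.eq_or_lt with rfl | hs1
    · rw [sub_self, zero_smul, one_mul]
      exact .zero h
    · rw [hsmul]
      refine .cons _ z (mul_pos (sub_pos.mpr hs1) hc) hz .refl ?_
      rwa [show a + s * c + (1 - s) * c = a + c by ring]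

end Seg

variable (R) in
/-- Lakshmibai–Seshadri paths of shape `μ`, recorded at level zero. -/
def IsLS (μ : V) (L : List (V × ℝ)) : Prop :=
  ∃ x y, R.Seg μ 1 y 0 x L

lemma IsLS.fList {μ : V} {L : List (V × ℝ)} (hL : R.IsLS μ L) {j : Fin r}
    (hf : (R.finOp j).fDef L) : R.IsLS μ ((R.finOp j).fList L) := by
  obtain ⟨x₀, y, hseg⟩ := hL
  obtain ⟨L₁, L₂, L₃, w, c, hLeq, hfL, hc0, hc1, hsuf, hpre, hlt, hsum⟩ :=
    (R.finOp j).fList_decomposition hf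
  have hL₂ : (R.finOp j).cov L₂.sum < 1 := hlt L₂ [] (by simp)
  rw [hLeq] at hseg
  obtain ⟨a, x, hseg₁, hseg'⟩ := hseg.exists_append
  obtain ⟨a', x', hseg₂, hseg₃⟩ := hseg'.exists_append
  have hw : 0 < (R.finOp j).cov w := by
    by_contra h
    have := mul_nonneg hc0.le (neg_nonneg.mpr (not_lt.mp h))
    linarith
  cases hseg₃ with
  | zero h => simp at hw
  | cons c₀ z hc₀ hz hch hseg₃ =>
  obtain ⟨hcut₁, hcut₂⟩ := Seg.cut hc₀ hz hch hseg₃ hc0 hc1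
  have hK := hseg₂.append hcut₁
  have hzpos : 0 < (⟪z, R.α j⟫ : ℝ) := by
    rw [finOp_cov, pairc_smul] at hw
    rw [← pairc_pos_iff _ (R.α_ne_zero j)]
    exact pos_of_mul_pos_right hw hc₀.le
  have hKsum : (R.finOp j).cov (L₂ ++ [c • ((c₀ • z, 0) : V × ℝ)]).sum = 1 := by
    rw [List.sum_append, map_add, List.sum_singleton, map_smul, smul_eq_mul, hsum]
  have hKpre : ∀ A B, L₂ ++ [c • ((c₀ • z, 0) : V × ℝ)] = A ++ B → A ≠ [] → B ≠ [] →
      0 < (R.finOp j).cov A.sum ∧ (R.finOp j).cov A.sum < 1 := by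
    intro A B hAB hA hB
    obtain ⟨B', rfl⟩ : ∃ B', L₂ = A ++ B' := by
      rcases List.append_eq_append_iff.mp hAB with ⟨E, h1, h2⟩ | ⟨E, h1, h2⟩
      · cases E with
        | nil => exact ⟨[], by simpa using h1.symm⟩
        | cons e E =>
          simp only [List.cons_append, List.cons.injEq] at h2
          have := h2.2
          simp at this
          exact absurd this.2 hB
      · exact ⟨E, h1⟩
    exact ⟨hpre A (B' ++ (c₀ • z, 0) :: L₃) (by simp) hA, hlt A B' rfl⟩
  have hfinal : (R.finOp j).fList L = L₁ ++ ((L₂ ++ [c • ((c₀ • z, 0) : V × ℝ)]).map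
      (R.finOp j).s ++ ((1 - c) • ((c₀ • z, 0) : V × ℝ)) :: L₃) := by
    rw [hfL]; simp
  have hhead : ∀ w' K', L₂ ++ [c • ((c₀ • z, 0) : V × ℝ)] = w' :: K' →
      0 < (R.finOp j).cov w' := by
    intro w' K' hK'
    rcases K' with _ | ⟨k, K'⟩
    · have := hKsum
      rw [hK'] at this
      simp only [List.sum_singleton] at this
      rw [this]; exact one_pos
    · simpa using (hKpre [w'] (k :: K') (by simpa using hK') (by simp) (by simp)).1
  rw [hfinal]
  generalize hKdef : L₂ ++ [c • ((c₀ • z, 0) : V × ℝ)] = K at *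
  have hKint := hK.exists_cov_sum_eq j
  rw [hKsum] at hKint
  cases hK with
  | nil => simp at hKdef
  | zero h =>
    have := hhead _ _ rfl
    simp at this
  | @cons _ _ K c₁ z₁ hc₁ hz₁ hch₁ hK =>
  have hz₁pos : 0 < (⟪z₁, R.α j⟫ : ℝ) := by
    have := hhead _ _ rfl
    rw [finOp_cov, pairc_smul] at this
    rw [← pairc_pos_iff _ (R.α_ne_zero j)]
    exact pos_of_mul_pos_right this hc₁.le
  have hstart : (∃ X X', R.Seg μ a X 0 X' L₁ ∧ R.AChain a (sLin (R.α j) z₁) X) ∧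
      ∃ n : ℤ, a * pairc z₁ (R.α j) = n := by
    rcases hseg₁.eq_or_nonpos hsuf with ⟨ha, -, -, hX⟩ | hx
    · subst ha
      exact ⟨⟨_, _, hX (sLin (R.α j) z₁), .refl⟩, 0, by simp⟩
    · rcases hch₁.reflect hz₁pos with ⟨h, -⟩ | ⟨h1, h2⟩
      · rw [← pairc_pos_iff _ (R.α_ne_zero j)] at h
        exact absurd h (not_lt.mpr hx)
      · exact ⟨⟨x, x₀, hseg₁, h1⟩, h2⟩
  obtain ⟨⟨X, X', hX, hXch⟩, n, hn⟩ := hstart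
  obtain ⟨hmap, -⟩ := hK.map_s hzpos (by
    intro A B hAB hB m hm
    have h1 := hKpre ((c₁ • z₁, 0) :: A) B (by rw [hAB]; rfl) (by simp) hB
    rw [List.sum_cons, map_add, finOp_cov, pairc_smul] at h1
    have h2 : c₁ * pairc z₁ (R.α j) + (R.finOp j).cov A.sum = ((m - n : ℤ) : ℝ) := by
      push_cast
      rw [← hm, ← hn]; ring
    simp only at h1
    rw [h2] at h1
    have h3 : 0 < m - n := by exact_mod_cast h1.1
    have h4 : m - n < 1 := by exact_mod_cast h1.2
    omega)
  have hK' : R.Seg μ (a' + c * c₀) (sLin (R.α j) z) a X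
      (List.map (R.finOp j).s ((c₁ • z₁, 0) :: K)) := by
    rw [List.map_cons, finOp_s]
    exact .cons c₁ _ hc₁ (R.sLin_α_mem_orbit hz₁ j) hXch hmap
  have hstep : R.AChain (a' + c * c₀) z (sLin (R.α j) z) := by
    refine .single ⟨R.α j, R.α_mem_pos j, hzpos, rfl, ?_, R.len_sLin_α hzpos⟩
    obtain ⟨m, hm⟩ := hKint
    obtain ⟨k, hk⟩ := hch₁.exists_sub_eq j
    refine ⟨1 - m + n - k, ?_⟩
    push_cast
    rw [← hn, ← hk]
    linarith
  obtain ⟨y', hy'⟩ := hcut₂.exists_of_aChain hstep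
  exact ⟨X', y', hX.append (hK'.append hy')⟩

lemma isLS_of_mem_finCrystal {μ : V} {L : List (V × ℝ)} (hL : L ∈ R.finCrystal μ) :
    R.IsLS μ L := by
  obtain ⟨L₀, rfl, h⟩ := hL
  induction h with
  | refl =>
    refine ⟨μ, μ, ?_⟩
    have := Seg.cons (R := R) (μ := μ) (b := 0 + 1) (a := 0) (x := μ) 1 μ one_pos
      (R.self_mem_orbit μ) .refl .nil
    simpa using this
  | tail _ h ih =>
    obtain ⟨j, hf, rfl⟩ := h
    exact ih.fList hf

end RootSystemBase

namespace RootSystemBase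

variable {V : Type*} [NormedAddCommGroup V] [InnerProductSpace ℝ V] {r : ℕ}
  (R : RootSystemBase r V)

/-- The points at which every positive root takes the value `0` or `t`. -/
def IsVertex (t : ℝ) (Q : V) : Prop := ∀ γ ∈ R.pos, ⟪Q, γ⟫ = (0 : ℝ) ∨ ⟪Q, γ⟫ = t

/-- The directions in which one can leave the vertex `Q` without leaving the alcove. -/
def IsInward (t : ℝ) (Q v : V) : Prop :=
  ∀ γ ∈ R.pos, (⟪Q, γ⟫ = (0 : ℝ) → (0 : ℝ) ≤ ⟪v, γ⟫) ∧ (⟪Q, γ⟫ = t → ⟪v, γ⟫ ≤ (0 : ℝ))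

/-- The points at which every positive root takes a value between `0` and `t`. -/
def InAlcove (t : ℝ) (x : V) : Prop := ∀ γ ∈ R.pos, 0 ≤ (⟪x, γ⟫ : ℝ) ∧ ⟪x, γ⟫ ≤ t

variable {R}

lemma inner_pos_of_mem_pos {ρ : V} (hρ : ∀ j, ⟪ρ, R.α j⟫ = (1 : ℝ)) {γ : V}
    (hγ : γ ∈ R.pos) : 0 < (⟪ρ, γ⟫ : ℝ) := by
  have hcone := R.inCone_of_mem_pos hγ
  have hsum : (⟪ρ, γ⟫ : ℝ) = ∑ k, R.basis.repr γ k := by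
    conv_lhs => rw [← R.sum_repr_smul γ]
    simp [inner_sum, real_inner_smul_right, hρ]
  rw [hsum]
  refine lt_of_le_of_ne (Finset.sum_nonneg fun k _ => hcone k) fun h => ?_
  rw [eq_comm, Finset.sum_eq_zero_iff_of_nonneg fun k _ => hcone k] at h
  refine R.ne_zero _ hγ.1 ?_
  rw [← R.sum_repr_smul γ]
  exact Finset.sum_eq_zero fun k hk => by rw [h k hk, zero_smul]

namespace IsMinWeight

variable {t : ℝ} {μ : V}

lemma exists_unique_inward (hμ : R.IsMinWeight t μ) {Q : V} (hQ : R.IsVertex t Q) :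
    ∃ v ∈ R.orbit μ, R.IsInward t Q v ∧ ∀ v' ∈ R.orbit μ, R.IsInward t Q v' → v' = v := by
  have ht := hμ.pos
  obtain ⟨ρ, hρ⟩ := R.exists_inner_α_eq_one
  obtain ⟨B, hB⟩ := (R.finite.image fun γ => (⟪ρ, γ⟫ : ℝ)).bddAbove
  have hB' : ∀ γ ∈ R.pos, (⟪ρ, γ⟫ : ℝ) ≤ B := fun γ hγ => hB ⟨γ, hγ.1, rfl⟩
  set η : V := ρ - ((B + 1) / t) • Q with hη
  have hη_eq : ∀ γ, (⟪η, γ⟫ : ℝ) = ⟪ρ, γ⟫ - (B + 1) / t * ⟪Q, γ⟫ := fun γ => by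
    rw [hη, inner_sub_left, real_inner_smul_left]
  have hη0 : ∀ γ ∈ R.pos, ⟪Q, γ⟫ = (0 : ℝ) → 0 < (⟪η, γ⟫ : ℝ) := fun γ hγ h => by
    rw [hη_eq, h, mul_zero, sub_zero]
    exact inner_pos_of_mem_pos hρ hγ
  have hηt : ∀ γ ∈ R.pos, ⟪Q, γ⟫ = t → (⟪η, γ⟫ : ℝ) < 0 := fun γ hγ h => by
    rw [hη_eq, h, div_mul_cancel₀ _ ht.ne']
    linarith [hB' γ hγ]
  obtain ⟨u, hu, hdom⟩ := R.exists_weyl_dominant η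
  have hinv : ∀ x, u (u⁻¹ x) = x := LinearEquiv.apply_symm_apply u
  have hmove : ∀ x y : V, (⟪u⁻¹ x, y⟫ : ℝ) = ⟪x, u y⟫ := fun x y => by
    rw [← R.inner_weyl hu, hinv]
  have hpos : ∀ γ ∈ R.roots, 0 < (⟪η, γ⟫ : ℝ) → u γ ∈ R.pos := fun γ hγ h => by
    refine (R.pos_or_neg_mem_pos (R.weyl_mem_roots hu hγ)).resolve_right fun hneg => ?_
    have := R.inner_nonneg_of_inCone hdom (R.inCone_of_mem_pos hneg)
    rw [inner_neg_right, R.inner_weyl hu] at this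
    linarith
  refine ⟨u⁻¹ μ, R.weyl_mem_orbit (R.self_mem_orbit μ) (R.weyl.inv_mem hu), ?_, ?_⟩
  · refine fun γ hγ => ⟨fun h => ?_, fun h => ?_⟩
    · rw [hmove]
      exact R.inner_nonneg_of_inCone hμ.dominant
        (R.inCone_of_mem_pos (hpos γ hγ.1 (hη0 γ hγ h)))
    · have h1 := hpos (-γ) (R.neg_mem_roots hγ.1) (by
        rw [inner_neg_right]; linarith [hηt γ hγ h])
      have h2 := R.inner_nonneg_of_inCone hμ.dominant (R.inCone_of_mem_pos h1)
      rw [map_neg, inner_neg_right] at h2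
      rw [hmove]; linarith
  · intro v' hv' hin
    have hdom' : R.Dominant (u v') := by
      intro j
      have h1 := hdom j
      have hmem := R.weyl_mem_roots (R.weyl.inv_mem hu) (R.simple_mem j)
      rw [← hinv (R.α j), R.inner_weyl hu] at h1 ⊢
      rcases R.pos_or_neg_mem_pos hmem with h | h
      · rcases hQ _ h with hq | hq
        · exact (hin _ h).1 hq
        · linarith [hηt _ h hq]
      · rcases hQ _ h with hq | hq
        · have := hη0 _ h hq
          rw [inner_neg_right] at this
          linarith
        · have := (hin _ h).2 hq
          rw [inner_neg_right] at this
          linarith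
    rw [← R.eq_of_mem_orbit_of_dominant hμ.dominant hdom' (R.weyl_mem_orbit hv' hu)]
    exact (LinearEquiv.symm_apply_apply u v').symm

lemma isVertex_add (hμ : R.IsMinWeight t μ) {Q v : V} (hQ : R.IsVertex t Q)
    (hv : v ∈ R.orbit μ) (hin : R.IsInward t Q v) : R.IsVertex t (Q + v) := by
  intro γ hγ
  have ht := hμ.pos
  rw [inner_add_left]
  rcases hQ γ hγ with h | h
  · have := (hin γ hγ).1 h
    rw [h, zero_add]
    exact (hμ.inner_orbit hv hγ.1).resolve_left fun h' => by linarith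
  · have := (hin γ hγ).2 h
    rcases hμ.inner_orbit hv hγ.1 with h' | h' | h'
    · left; linarith
    · right; linarith
    · linarith

lemma inAlcove_add_smul {Q v : V} (hQ : R.IsVertex t Q) (hQv : R.IsVertex t (Q + v))
    (ht : 0 < t) {s : ℝ} (hs : 0 ≤ s) (hs1 : s ≤ 1) : R.InAlcove t (Q + s • v) := by
  intro γ hγ
  have h1 := hQ γ hγ
  have h2 := hQv γ hγ
  rw [inner_add_left] at h2
  rw [inner_add_left, real_inner_smul_left]
  have hst := mul_nonneg hs ht.le
  have hst1 := mul_nonneg (sub_nonneg.mpr hs1) ht.le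
  rcases h1 with h1 | h1 <;> rcases h2 with h2 | h2 <;> rw [h1] at h2 ⊢
  · rw [show (⟪v, γ⟫ : ℝ) = 0 by linarith]; constructor <;> linarith
  · rw [show (⟪v, γ⟫ : ℝ) = t by linarith]; constructor <;> linarith
  · rw [show (⟪v, γ⟫ : ℝ) = -t by linarith]; constructor <;> linarith
  · rw [show (⟪v, γ⟫ : ℝ) = 0 by linarith]; constructor <;> linarith

/-- At an intermediate time no chain ends in the inward direction at a vertex. -/
lemma eq_of_aChain (hμ : R.IsMinWeight t μ) {Q v : V} (hQ : R.IsVertex t Q)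
    (hv : v ∈ R.orbit μ) (hin : R.IsInward t Q v) {a : ℝ} (ha : 0 < a) (ha1 : a < 1) {z : V}
    (h : R.AChain a z v) : z = v := by
  rcases Relation.ReflTransGen.cases_tail h with h | ⟨x, -, β, hβ, hβx, hvx, ⟨k, hk⟩, hlen⟩
  · exact h.symm
  exfalso
  have ht := hμ.pos
  have hβ0 := R.ne_zero _ hβ.1
  have hββ := inner_self_pos_of_ne_zero hβ0
  have hxv : x = sLin β v := by rw [hvx, sLin_sLin hβ0]
  have hvβ' : (⟪v, β⟫ : ℝ) = -⟪x, β⟫ := by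
    rw [hvx, inner_sLin_left, sLin_self hβ0, inner_neg_right]
  have hvβ : ⟪v, β⟫ = -t := hμ.inner_orbit_neg hv hβ.1 (by linarith)
  have hQβ : ⟪Q, β⟫ = t := (hQ β hβ).resolve_left fun h => by
    linarith [(hin β hβ).1 h]
  obtain ⟨p, hp0, hp⟩ := hμ.exists_norm_mul hβ.1
  have hpx : pairc x β = p := by
    rw [pairc_eq, show (⟪x, β⟫ : ℝ) = t by linarith, hp, mul_div_cancel_right₀ _ hββ.ne']
  have hp2 : 2 ≤ p := by
    by_contra hlt
    obtain rfl : p = 1 := by omega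
    rw [hpx, Nat.cast_one, mul_one] at hk
    rw [hk] at ha ha1
    norm_cast at ha ha1
    omega
  have hp2' : (2 : ℝ) ≤ p := by exact_mod_cast hp2
  obtain ⟨δ, hδ, hδδ, hδβ⟩ := hμ.long β hβ.1
  have hδ0 := R.ne_zero _ hδ
  obtain ⟨n, hn⟩ := R.cryst _ hδ _ hβ.1
  have hn1 := pairc_mul β hδ0
  rw [hn, hδδ, real_inner_comm δ β] at hn1
  have hδβ_eq : (⟪δ, β⟫ : ℝ) = n * t := by linarith
  have hn0 : 1 ≤ n := by
    have : (0 : ℝ) < n := by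
      by_contra h
      nlinarith
    exact_mod_cast this
  have hn0' : (1 : ℝ) ≤ n := by exact_mod_cast hn0
  have hm : pairc δ β = n * p := by
    rw [pairc_eq, div_eq_iff hββ.ne', hδβ_eq, mul_assoc, ← hp]; ring
  set δ' : V := -sLin β δ with hδ'
  have hδ'mem : δ' ∈ R.roots := R.neg_mem_roots (R.reflect_mem _ hβ.1 _ hδ)
  have hinner : ∀ y : V, (⟪y, δ'⟫ : ℝ) = n * p * ⟪y, β⟫ - ⟪y, δ⟫ := fun y => by
    rw [hδ', inner_neg_right, sLin_apply, inner_sub_right, real_inner_smul_right, hm]; ring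
  have horb : ∀ γ ∈ R.roots, -t ≤ (⟪v, γ⟫ : ℝ) := fun γ hγ => by
    rcases hμ.inner_orbit hv hγ with h | h | h <;> linarith
  have h1 := horb _ hδ
  have h2 := horb _ hδ'mem
  rw [hinner, hvβ] at h2
  have hnp : (n : ℝ) * p ≤ 2 := by
    by_contra h
    nlinarith
  have hnp2 : (2 : ℝ) ≤ n * p := by nlinarith
  have hn_eq : (n : ℝ) = 1 := by nlinarith
  have hp_eq : (p : ℝ) = 2 := by nlinarith
  rw [hn_eq, hp_eq] at h2
  have hvδ : (⟪v, δ⟫ : ℝ) = -t := by linarith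
  have hQle : ∀ γ ∈ R.roots, (⟪Q, γ⟫ : ℝ) ≤ t ∧ ((⟪Q, γ⟫ : ℝ) = t → γ ∈ R.pos) := by
    intro γ hγ
    rcases R.pos_or_neg_mem_pos hγ with h | h
    · exact ⟨by rcases hQ γ h with h | h <;> linarith, fun _ => h⟩
    · have h3 := hQ _ h
      rw [inner_neg_right] at h3
      constructor
      · rcases h3 with h3 | h3 <;> linarith
      · intro h4
        rcases h3 with h3 | h3 <;> linarith
  have hQδ := hQle _ hδ
  have hQδ' := hQle _ hδ'mem
  have hQδ'v := hinner Q
  rw [hn_eq, hp_eq, hQβ] at hQδ'v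
  have hδpos : δ ∈ R.pos := hQδ.2 (by linarith [hQδ.1, hQδ'.1])
  have hδ'pos : δ' ∈ R.pos := hQδ'.2 (by linarith [hQδ.1, hQδ'.1])
  have hδ'δ' : (⟪δ', δ'⟫ : ℝ) = 2 * t := by
    rw [hδ', inner_neg_neg, inner_sLin_sLin hβ0, hδδ]
  have hpv : pairc v δ = -1 := by
    rw [pairc_eq, hvδ, hδδ, mul_neg, neg_div, div_self (by positivity)]
  have hz : sLin δ (sLin δ v) = v := sLin_sLin hδ0 v
  have hzv : sLin δ v = v + δ := by rw [sLin_apply, hpv]; simp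
  have hlen1 := R.len_lt_len_sLin (x := sLin δ v) hδpos (by
    rw [inner_sLin_left, sLin_self hδ0, inner_neg_right, hvδ]; linarith)
  rw [hz] at hlen1
  have hββ' : (⟪β, β⟫ : ℝ) = t := by
    rw [hp_eq] at hp; linarith
  have hxδ' : (⟪x, δ'⟫ : ℝ) = t := by
    rw [hinner, hn_eq, hp_eq, show (⟪x, β⟫ : ℝ) = t by linarith, hxv, inner_sLin_left,
      sLin_apply, inner_sub_right, real_inner_smul_right, hm, hn_eq, hp_eq, hvδ, hvβ]
    ring
  have hxz : sLin δ' x = sLin δ v := by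
    have hpv' : pairc v β = -2 := by
      rw [pairc_eq, hvβ, hββ', mul_neg, neg_div, mul_div_cancel_right₀ _ ht.ne']
    have hpx' : pairc x δ' = 1 := by
      rw [pairc_eq, hxδ', hδ'δ', div_self (by positivity)]
    rw [sLin_apply δ' x, hpx', hδ', hzv, sLin_apply β δ, hm, hxv, sLin_apply, hpv', hn_eq, hp_eq]
    module
  have hlen2 := R.len_lt_len_sLin (x := x) hδ'pos (by rw [hxδ']; exact ht)
  rw [hxz] at hlen2
  omega

lemma along_of_seg (hμ : R.IsMinWeight t μ) {Q v : V} (hQ : R.IsVertex t Q)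
    (hv : v ∈ R.orbit μ) (hin : R.IsInward t Q v)
    (huniq : ∀ v' ∈ R.orbit μ, R.IsInward t Q v' → v' = v) {b a : ℝ} {x y : V}
    {L : List (V × ℝ)} (h : R.Seg μ b y a x L) (hb : b ≤ 1) (ha : 0 ≤ a)
    (hax : a = 0 ∨ x = v)
    (hL : ∀ A B, L = A ++ B → R.InAlcove t (Q + a • v + A.sum.1)) :
    Along ((v, 0) : V × ℝ) (b - a) L := by
  induction h with
  | nil => rw [sub_self]; exact .nil
  | @zero a x L _ ih =>
    have := ih ha hax fun A B hAB => by simpa using hL (0 :: A) B (by rw [hAB]; rfl)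
    simpa using Along.cons le_rfl this
  | @cons a x L c z hc hz hch hseg ih =>
    have hcb := hseg.le
    obtain rfl : z = v := by
      rcases ha.eq_or_lt with rfl | ha
      · refine huniq z hz fun γ hγ => ?_
        have h1 := hL [(c • z, 0)] L rfl γ hγ
        simp only [zero_smul, add_zero, List.sum_singleton, inner_add_left,
          real_inner_smul_left] at h1
        constructor
        · intro h2
          rw [h2, zero_add] at h1
          exact nonneg_of_mul_nonneg_right h1.1 hc
        · intro h2
          rw [h2] at h1
          by_contra hlt
          have := mul_pos hc (not_le.mp hlt)
          linarith [h1.2]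
      · rw [hax.resolve_left ha.ne'] at hch
        exact hμ.eq_of_aChain hQ hv hin ha (by linarith) hch
    have := ih (by positivity) (.inr rfl) fun A B hAB => by
      have := hL ((c • z, 0) :: A) B (by rw [hAB]; rfl)
      rw [List.sum_cons, Prod.fst_add, ← add_assoc] at this
      rwa [add_smul, ← add_assoc]
    have h3 := Along.cons hc.le this
    rw [show c + (b - (a + c)) = b - a by ring] at h3
    simpa using h3

lemma along_of_mem_finCrystal (hμ : R.IsMinWeight t μ) {Q v : V} (hQ : R.IsVertex t Q)
    (hv : v ∈ R.orbit μ) (hin : R.IsInward t Q v)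
    (huniq : ∀ v' ∈ R.orbit μ, R.IsInward t Q v' → v' = v) {L : List (V × ℝ)}
    (hmem : L ∈ R.finCrystal μ) (hL : ∀ A B, L = A ++ B → R.InAlcove t (Q + A.sum.1)) :
    Along ((v, 0) : V × ℝ) 1 L := by
  obtain ⟨x, y, hseg⟩ := isLS_of_mem_finCrystal hmem
  have := hμ.along_of_seg hQ hv hin huniq hseg le_rfl le_rfl (.inl rfl)
    (by simpa using hL)
  simpa using this

end IsMinWeight
end RootSystemBase

namespace RootSystemBase

variable {V : Type*} [NormedAddCommGroup V] [InnerProductSpace ℝ V] {r : ℕ}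
  {R : RootSystemBase r V}

lemma fList_mem_finCrystal {μ : V} {L : List (V × ℝ)} (hL : L ∈ R.finCrystal μ) {j : Fin r}
    (hf : (R.finOp j).fDef L) : (R.finOp j).fList L ∈ R.finCrystal μ := by
  obtain ⟨L₀, h₀, h⟩ := hL
  exact ⟨L₀, h₀, h.tail ⟨j, hf, rfl⟩⟩

lemma finOp_cov_along {j : Fin r} {v : V} {s : ℝ} {L : List (V × ℝ)}
    (h : Along ((v, 0) : V × ℝ) s L) : (R.finOp j).cov L.sum = s * pairc v (R.α j) := by
  rw [h.sum_eq, map_smul, finOp_cov, smul_eq_mul]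

/-- One more application of the root operator moves the bend of a two-piece path. -/
lemma fList_along {j : Fin r} {v v' : V} {n k : ℕ} (hn : pairc v' (R.α j) = n)
    (hv : sLin (R.α j) v' = v) (hkn : k < n) {A B : List (V × ℝ)}
    (hA : Along ((v, 0) : V × ℝ) (k / n) A) (hB : Along ((v', 0) : V × ℝ) (1 - k / n) B) :
    (R.finOp j).fDef (A ++ B) ∧ ∃ A' B', (R.finOp j).fList (A ++ B) = A' ++ B' ∧
      Along ((v, 0) : V × ℝ) ((k + 1 : ℕ) / n) A' ∧
      Along ((v', 0) : V × ℝ) (1 - (k + 1 : ℕ) / n) B' := by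
  have hnpos : (0 : ℝ) < n := by exact_mod_cast (Nat.zero_le k).trans_lt hkn
  have hvn : pairc v (R.α j) = -n := by
    rw [← hv, pairc_sLin_self (R.α_ne_zero j), hn]
  have hAsum := finOp_cov_along (R := R) (j := j) hA
  have hBsum := finOp_cov_along (R := R) (j := j) hB
  rw [hvn, mul_neg, div_mul_cancel₀ _ hnpos.ne'] at hAsum
  rw [hn, sub_mul, one_mul, div_mul_cancel₀ _ hnpos.ne'] at hBsum
  have hkn' : (k : ℝ) + 1 ≤ n := by exact_mod_cast hkn
  have hf : (R.finOp j).fDef (A ++ B) := by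
    obtain ⟨h1, h2, -⟩ := (R.finOp j).lastMin_spec (A ++ B)
    have h3 := (R.finOp j).minH_le (A ++ B) A.length
    have h4 : (R.finOp j).hgt (A ++ B) A.length = -k := by
      rw [RootOp.hgt, List.take_left, hAsum]
    have h5 : (R.finOp j).hgt (A ++ B) (A ++ B).length = -k + (n - k) := by
      rw [RootOp.hgt, List.take_length, List.sum_append, map_add, hAsum, hBsum]
    refine ⟨_, le_rfl, lt_of_le_of_ne h1 fun h => ?_, by linarith⟩
    rw [h, h5] at h2
    linarith
  refine ⟨hf, ?_⟩
  obtain ⟨L₁, L₂, L₃, w, c, hLeq, hfL, hc0, hc1, hsuf, hpre, -, hsum⟩ :=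
    (R.finOp j).fList_decomposition hf
  obtain ⟨E, rfl, rfl⟩ : ∃ E, L₁ = A ++ E ∧ B = E ++ (L₂ ++ w :: L₃) := by
    rcases List.append_eq_append_iff.mp hLeq with ⟨E, h1, h2⟩ | ⟨E, h1, h2⟩
    · exact ⟨E, h1, h2⟩
    · have hE : E = [] := by
        by_contra hE
        have h3 := hpre E B h2 hE
        rw [h1] at hA
        obtain ⟨_, e, -, -, he⟩ := hA.of_append
        rw [finOp_cov_along he, hvn] at h3
        nlinarith [mul_nonneg he.nonneg hnpos.le]
      subst hE
      exact ⟨[], by simpa using h1.symm, by simpa using h2.symm⟩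
  obtain ⟨e, _, heq, he, hrest⟩ := hB.of_append
  obtain ⟨l₂, _, rfl, hl₂, hrest⟩ := hrest.of_append
  have he0 : e = 0 := by
    have h := hsuf A E rfl
    rw [finOp_cov_along he, hn] at h
    refine le_antisymm ?_ he.nonneg
    by_contra hlt
    have := mul_pos (not_le.mp hlt) hnpos
    linarith
  cases hrest with
  | @cons l₃ ω _ hω hl₃ =>
  rw [finOp_cov_along hl₂, map_smul, finOp_cov, hn, smul_eq_mul] at hsum
  have hs : l₂ + c * ω = 1 / n := by
    rw [eq_div_iff hnpos.ne', ← hsum]; ring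
  refine ⟨A ++ (E ++ (L₂.map (R.finOp j).s ++ [(R.finOp j).s (c • ω • (v', 0))])),
    (1 - c) • ω • (v', 0) :: L₃, by rw [hfL]; simp, ?_, ?_⟩
  · have hsmul : ∀ u : ℝ, (R.finOp j).s (u • (v', 0)) = u • (v, 0) := fun u => by
      rw [Prod.smul_mk, Prod.smul_mk, smul_zero, finOp_s, hv]
    have h := hA.append ((he.of_eq_zero he0 (v, 0)).append ((hl₂.map hsmul).append
      (Along.single (mul_nonneg hc0.le hω))))
    rw [smul_smul, hsmul]
    have heq' : (((k + 1 : ℕ) : ℝ) / n) = k / n + (0 + (l₂ + c * ω)) := by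
      rw [hs]; push_cast; ring
    rwa [heq']
  · have h := Along.cons (v := ((v', 0) : V × ℝ)) (mul_nonneg (sub_nonneg.mpr hc1) hω) hl₃
    rw [smul_smul]
    have heq' : 1 - (((k + 1 : ℕ) : ℝ) / n) = (1 - c) * ω + l₃ := by
      have : (((k + 1 : ℕ) : ℝ) / n) = k / n + 1 / n := by push_cast; ring
      rw [this, ← hs]
      linarith
    rwa [heq']

namespace IsMinWeight

variable {t : ℝ} {μ : V}

/-- Every straight path in the orbit of `μ` lies in the crystal, up to subdivision. -/
lemma exists_along_mem_finCrystal (hμ : R.IsMinWeight t μ) {v : V} (hv : v ∈ R.orbit μ) :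
    ∃ L ∈ R.finCrystal μ, Along ((v, 0) : V × ℝ) 1 L := by
  induction hlen : R.len v using Nat.strong_induction_on generalizing v with
  | _ m ih =>
  by_cases hdom : R.Dominant v
  · refine ⟨[(μ, 0)], ⟨_, rfl, .refl⟩, ?_⟩
    rw [R.eq_of_mem_orbit_of_dominant hμ.dominant hdom hv]
    simpa using Along.single (v := ((μ, 0) : V × ℝ)) zero_le_one
  · simp only [Dominant, not_forall, not_le] at hdom
    obtain ⟨j, hj⟩ := hdom
    have h0 := R.α_ne_zero j
    set v' := sLin (R.α j) v with hv'
    have hvv' : sLin (R.α j) v' = v := sLin_sLin h0 v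
    have hv'mem : v' ∈ R.orbit μ := R.sLin_α_mem_orbit hv j
    have hpos : 0 < (⟪v', R.α j⟫ : ℝ) := by
      rw [hv', inner_sLin_left, sLin_self h0, inner_neg_right]; linarith
    have hl := R.len_sLin_α hpos
    rw [hvv', hlen] at hl
    obtain ⟨L₀, hL₀, hL₀'⟩ := ih _ (by omega) hv'mem rfl
    obtain ⟨n, hn⟩ := hμ.pairc_orbit hv'mem (R.simple_mem j)
    have hn0 : 0 < n := by
      rw [← pairc_pos_iff _ h0, hn] at hpos
      exact_mod_cast hpos
    lift n to ℕ using hn0.le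
    rw [Int.cast_natCast] at hn
    norm_cast at hn0
    have key : ∀ k ≤ n, ∃ A B, A ++ B ∈ R.finCrystal μ ∧
        Along ((v, 0) : V × ℝ) (k / n) A ∧ Along ((v', 0) : V × ℝ) (1 - k / n) B := by
      intro k
      induction k with
      | zero => exact fun _ => ⟨[], L₀, hL₀, by simpa using Along.nil, by simpa using hL₀'⟩
      | succ k ihk =>
        intro hk
        obtain ⟨A, B, hAB, hA, hB⟩ := ihk (by omega)
        obtain ⟨hf, A', B', h1, h2, h3⟩ := fList_along hn hvv' hk hA hB
        exact ⟨A', B', h1 ▸ fList_mem_finCrystal hAB hf, h2, h3⟩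
    obtain ⟨A, B, hAB, hA, hB⟩ := key n le_rfl
    rw [div_self (by exact_mod_cast hn0.ne')] at hA hB
    refine ⟨_, hAB, ?_⟩
    simpa using hA.append (hB.of_eq_zero (sub_self 1) (v, 0))

lemma exists_unique_path (hμ : R.IsMinWeight t μ) (N : ℕ) {Q : V} (hQ : R.IsVertex t Q) :
    ∃ L ∈ catSets (List.replicate N (R.finCrystal μ)),
      (∀ A B, L = A ++ B → R.InAlcove t (Q + A.sum.1)) ∧
      ∀ L' ∈ catSets (List.replicate N (R.finCrystal μ)),
        (∀ A B, L' = A ++ B → R.InAlcove t (Q + A.sum.1)) → normalize L' = normalize L := by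
  induction N generalizing Q with
  | zero =>
    refine ⟨[], rfl, ?_, ?_⟩
    · intro A B hAB γ hγ
      obtain ⟨rfl, -⟩ := List.append_eq_nil_iff.mp hAB.symm
      rcases hQ γ hγ with h | h <;> simp [h, hμ.pos.le]
    · rintro L' rfl -
      rfl
  | succ N ih =>
    obtain ⟨v, hv, hin, huniq⟩ := hμ.exists_unique_inward hQ
    have hQv := hμ.isVertex_add hQ hv hin
    obtain ⟨L₁, hL₁, hL₁v⟩ := hμ.exists_along_mem_finCrystal hv
    obtain ⟨L₂, hL₂, hin₂, huniq₂⟩ := ih hQv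
    have hsum : ∀ {L : List (V × ℝ)} {s : ℝ}, Along ((v, 0) : V × ℝ) s L →
        L.sum.1 = s • v := fun h => by
      rw [h.sum_eq, Prod.smul_fst]
    refine ⟨L₁ ++ L₂, ⟨L₁, hL₁, L₂, hL₂, rfl⟩, ?_, ?_⟩
    · intro A B hAB
      rcases List.append_eq_append_iff.mp hAB with ⟨E, rfl, h2⟩ | ⟨E, rfl, -⟩
      · have := hin₂ E B h2
        rwa [List.sum_append, Prod.fst_add, hsum hL₁v, one_smul, ← add_assoc]
      · obtain ⟨a, b, hab, ha, hb⟩ := hL₁v.of_append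
        rw [hsum ha]
        exact inAlcove_add_smul hQ hQv hμ.pos ha.nonneg (by linarith [hb.nonneg])
    · rintro _ ⟨L₁', hL₁', L₂', hL₂', rfl⟩ hL'
      change ∀ A B, L₁' ++ L₂' = A ++ B → R.InAlcove t (Q + A.sum.1) at hL'
      change normalize (L₁' ++ L₂') = normalize (L₁ ++ L₂)
      have h1 := hμ.along_of_mem_finCrystal hQ hv hin huniq hL₁' fun A B hAB =>
        hL' A (B ++ L₂') (by rw [hAB, List.append_assoc])
      have h2 := huniq₂ L₂' hL₂' fun A B hAB => by
        have := hL' (L₁' ++ A) B (by rw [hAB, List.append_assoc])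
        rwa [List.sum_append, Prod.fst_add, hsum h1, one_smul, ← add_assoc] at this
      rw [h1.normalize_append, hL₁v.normalize_append, h2]

end IsMinWeight

lemma affOp_cov_nonneg_iff {θ : V} (hθ : R.IsHighestRoot θ) (x : V) :
    (∀ i, 0 ≤ (R.affOp θ i).cov (x, 1)) ↔ R.InAlcove (⟪θ, θ⟫ / 2) x := by
  have hzero : (R.affOp θ 0).cov (x, 1) = 1 - pairc x θ := by
    simp [affOp, affCovF, pairc, real_inner_comm]
  have hsucc : ∀ j : Fin r, (R.affOp θ j.succ).cov (x, 1) = pairc x (R.α j) :=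
    fun j => finOp_cov j (x, 1)
  have hθθ := inner_self_pos_of_ne_zero (R.ne_zero _ hθ.1.1)
  have hiff : 0 ≤ 1 - pairc x θ ↔ (⟪x, θ⟫ : ℝ) ≤ ⟪θ, θ⟫ / 2 := by
    rw [sub_nonneg, pairc_eq, div_le_one hθθ]
    constructor <;> intro h <;> linarith
  rw [Fin.forall_fin_succ]
  simp only [hzero, hsucc, hiff, pairc_nonneg_iff _ (R.α_ne_zero _)]
  constructor
  · rintro ⟨h1, h2⟩ γ hγ
    obtain ⟨c, hc⟩ := hθ.2 γ hγ.1
    have h3 := R.inner_nonneg_of_inCone h2 (hc ▸ R.inCone_sum_natCast c : R.InCone (θ - γ))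
    rw [inner_sub_right] at h3
    exact ⟨R.inner_nonneg_of_inCone h2 (R.inCone_of_mem_pos hγ), by linarith⟩
  · exact fun h => ⟨(h θ hθ.1).2, fun j => (h _ (R.α_mem_pos j)).1⟩

lemma affDominant_lamZero_append_iff {θ : V} (hθ : R.IsHighestRoot θ) {L : List (V × ℝ)}
    (hL : ∀ w ∈ L, w.2 = 0) :
    R.AffDominant θ ([lamZero] ++ L) ↔
      ∀ A B, L = A ++ B → R.InAlcove (⟪θ, θ⟫ / 2) (0 + A.sum.1) := by
  have hsnd : ∀ A : List (V × ℝ), (∀ w ∈ A, w.2 = 0) → A.sum.2 = 0 := by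
    intro A hA
    induction A with
    | nil => rfl
    | cons w A ih =>
      rw [List.forall_mem_cons] at hA
      rw [List.sum_cons, Prod.snd_add, hA.1, ih hA.2, add_zero]
  have hsum : ∀ A B, L = A ++ B → ([lamZero] ++ A).sum = (0 + A.sum.1, (1 : ℝ)) := by
    rintro A B rfl
    have := hsnd A fun w hw => hL w (List.mem_append_left _ hw)
    ext <;> simp [lamZero, this]
  constructor
  · intro h A B hAB
    rw [← affOp_cov_nonneg_iff hθ]
    intro i
    have := h (A.length + 1) (by simp [hAB]) i
    rwa [RootOp.hgt, hAB, List.singleton_append, List.take_succ_cons, List.take_left,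
      ← List.singleton_append, hsum A B hAB] at this
  · rintro h (_ | k) hk i
    · simp [RootOp.hgt]
    · have hAB := (List.take_append_drop k L).symm
      rw [RootOp.hgt, List.singleton_append, List.take_succ_cons, ← List.singleton_append,
        hsum _ _ hAB]
      exact (affOp_cov_nonneg_iff hθ _).mpr (h _ _ hAB) i

lemma snd_eq_zero_of_mem_catSets {μ : V} {N : ℕ} {L : List (V × ℝ)}
    (hL : L ∈ catSets (List.replicate N (R.finCrystal μ))) : ∀ w ∈ L, w.2 = 0 := by
  induction N generalizing L with
  | zero =>
    obtain rfl : L = [] := hL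
    simp
  | succ N ih =>
    obtain ⟨L₁, hL₁, L₂, hL₂, rfl⟩ := hL
    obtain ⟨x, y, hseg⟩ := isLS_of_mem_finCrystal hL₁
    intro w hw
    rcases List.mem_append.mp hw with h | h
    · exact hseg.snd_eq_zero w h
    · exact ih hL₂ w h

end RootSystemBase

/-- **Uniqueness of the dominant path in `Λ₀ ⋆ B(ϖ*)^{⋆N}`** (Magyar, Theorem 4, first
assertion).  Let `ϖ∨` be a minuscule fundamental coweight with fundamental weight `ϖ`,
`ϖ* = -w₀ ϖ`, and let `N` be the smallest positive integer such that `N ϖ∨` lies in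
the coroot lattice.  Then the set of concatenations
`Λ₀ ⋆ B(ϖ*) ⋆ ⋯ ⋆ B(ϖ*)` (with `N` factors `B(ϖ*)`) contains exactly one
affine-dominant path (up to reparametrization). -/
theorem unique_dominant_path_in_level_one_concatenation
    {V : Type*} [NormedAddCommGroup V] [InnerProductSpace ℝ V] {r : ℕ}
    (R : RootSystemBase r V)
    (θ : V) (hθ : R.IsHighestRoot θ)
    (i : Fin r) (c : V) (hc : R.IsFundCoweight i c) (hmin : R.IsMinusculeCoweight c)
    (ϖ : V) (hϖ : R.IsFundWeight i ϖ)
    (w₀ : V ≃ₗ[ℝ] V) (hw₀ : R.IsLongest w₀)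
    (N : ℕ) (hN0 : 0 < N)
    (hNlat : (N : ℤ) • c ∈ R.corootLattice)
    (hNmin : ∀ k : ℕ, 0 < k → (k : ℤ) • c ∈ R.corootLattice → N ≤ k) :
    letI S : Set (List (V × ℝ)) :=
      starSet {[lamZero (V := V)]}
        (catSets (List.replicate N (R.finCrystal (-(w₀ ϖ)))))
    ∃ L ∈ S, R.AffDominant θ L ∧
      ∀ L' ∈ S, R.AffDominant θ L' → normalize L' = normalize L := by
  have hμ := RootSystemBase.isMinWeight_neg_longest hθ hc hmin hϖ hw₀
  obtain ⟨L, hL, hin, huniq⟩ := hμ.exists_unique_path N (Q := 0) fun γ _ => .inl (by simp)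
  refine ⟨[lamZero] ++ L, ⟨_, rfl, L, hL, rfl⟩, ?_, ?_⟩
  · exact (RootSystemBase.affDominant_lamZero_append_iff hθ
      (RootSystemBase.snd_eq_zero_of_mem_catSets hL)).mpr hin
  · rintro _ ⟨_, rfl, L', hL', rfl⟩ hdom
    have h := huniq L' hL' ((RootSystemBase.affDominant_lamZero_append_iff hθ
      (RootSystemBase.snd_eq_zero_of_mem_catSets hL')).mp hdom)
    change consStep lamZero (normalize L') = consStep lamZero (normalize L)
    rw [h]

end Litt
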